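/- arXiv:2110.04141 — 3 statements merged into one kernel-verified Lean document; each statement's English description precedes it below -/
import Mathlib

section
/- Let G be a countable group admitting a chain of infinite subgroups G₀ ⊆ G₁ ⊆ … ⊆ G_n = G such that (1) for every k ∈ {1,…,n}, the set of all g ∈ G_k with gG_{k−1}g⁻¹ ∩ G_{k−1} infinite generates G_k, and (2) the centralizer of G₀ in G is nonamenable. Let G ↷ X be a nontrivial Bernoulli action of G and let H be any countable group. Then every cocycle c : G × X → H is cohomologous to a cocycle of the form (g,x) ↦ δ(g) for some group homomorphism δ : G → H. -/
open MeasureTheory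
open scoped ENNReal Pointwise symmDiff

namespace OEPaper

/- ## Right-angled Artin groups and graph combinatorics -/

/-- The commutation relations defining the right-angled Artin group of a graph. -/
def raagRels {V : Type} (Γ : SimpleGraph V) : Set (FreeGroup V) :=
  {r | ∃ u v : V, Γ.Adj u v ∧
    r = FreeGroup.of u * FreeGroup.of v * (FreeGroup.of u)⁻¹ * (FreeGroup.of v)⁻¹}

/-- The right-angled Artin group of a simple graph `Γ`. -/
abbrev RAAG {V : Type} (Γ : SimpleGraph V) : Type := PresentedGroup (raagRels Γ)

/-- The standard generator of `RAAG Γ` associated to a vertex. -/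
def gen {V : Type} (Γ : SimpleGraph V) (v : V) : RAAG Γ := PresentedGroup.of v

/-- The standard subgroup associated to (the full subgraph spanned by) a set of vertices. -/
def standardSub {V : Type} (Γ : SimpleGraph V) (S : Set V) : Subgroup (RAAG Γ) :=
  Subgroup.closure (gen Γ '' S)

/-- Conjugate of a subgroup. -/
def conjSub {G : Type} [Group G] (g : G) (P : Subgroup G) : Subgroup G :=
  Subgroup.map (MulAut.conj g).toMonoidHom P

/-- Parabolic subgroups: conjugates of standard subgroups. -/
def IsParabolic {V : Type} (Γ : SimpleGraph V) (P : Subgroup (RAAG Γ)) : Prop :=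
  ∃ (g : RAAG Γ) (S : Set V), P = conjSub g (standardSub Γ S)

/-- The "orthogonal" of a set of vertices: vertices outside `S` adjacent to every vertex of `S`. -/
def perp {V : Type} (Γ : SimpleGraph V) (S : Set V) : Set V :=
  {v : V | v ∉ S ∧ ∀ u ∈ S, Γ.Adj v u}

/-- `S` spans a join subgraph of `Γ`. -/
def IsJoin {V : Type} (Γ : SimpleGraph V) (S : Set V) : Prop :=
  ∃ S₁ S₂ : Set V, S₁.Nonempty ∧ S₂.Nonempty ∧ S₁ ∪ S₂ = S ∧ ∀ u ∈ S₁, ∀ v ∈ S₂, Γ.Adj u v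

/-- `S` spans a maximal join subgraph of `Γ`. -/
def IsMaxJoin {V : Type} (Γ : SimpleGraph V) (S : Set V) : Prop :=
  IsJoin Γ S ∧ ∀ T : Set V, IsJoin Γ T → S ⊆ T → S = T

/-- Join parabolic subgroups. -/
def IsJoinParabolic {V : Type} (Γ : SimpleGraph V) (P : Subgroup (RAAG Γ)) : Prop :=
  ∃ (g : RAAG Γ) (S : Set V), IsJoin Γ S ∧ P = conjSub g (standardSub Γ S)

/-- Maximal join parabolic subgroups. -/
def IsMaxJoinParabolic {V : Type} (Γ : SimpleGraph V) (P : Subgroup (RAAG Γ)) : Prop :=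
  ∃ (g : RAAG Γ) (S : Set V), IsMaxJoin Γ S ∧ P = conjSub g (standardSub Γ S)

/-- The center of a subgroup `P`, as a subset of the ambient group. -/
def subCenter {G : Type} [Group G] (P : Subgroup G) : Set G :=
  {x : G | x ∈ P ∧ ∀ y ∈ P, x * y = y * x}

/-- The commutation graph of a subset `S` of a group. -/
def chainCommGraph {G : Type} [Group G] (S : Set G) : SimpleGraph S :=
  SimpleGraph.fromRel fun a b => Commute (a : G) (b : G)

/-- A generating set is chain-commuting if its commutation graph is connected. -/
def IsChainCommuting {G : Type} [Group G] (S : Set G) : Prop :=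
  (chainCommGraph S).Connected

/-- Amenability: existence of a finitely additive left-invariant probability
measure defined on all subsets. -/
def IsAmenable (G : Type) [Group G] : Prop :=
  ∃ m : Set G → ℝ, m Set.univ = 1 ∧ (∀ A : Set G, 0 ≤ m A) ∧
    (∀ A B : Set G, Disjoint A B → m (A ∪ B) = m A + m B) ∧
    ∀ (g : G) (A : Set G), m ((g * ·) '' A) = m A

/-- ICC groups: every nontrivial element has an infinite conjugacy class. -/
def IsICC (G : Type) [Group G] : Prop :=
  ∀ g : G, g ≠ 1 → {h : G | ∃ c : G, c * g * c⁻¹ = h}.Infinite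

/-- The root-conjugation property. -/
def RootConjugationProperty (H : Type) [Group H] : Prop :=
  ∀ (h₁ h₂ : H) (k : ℕ), 0 < k → Commute h₁ (h₂ ^ k) → Commute h₁ h₂

/- ## Measured dynamics -/

/-- Measure-preserving action by measurable automorphisms. -/
def PmpAction (G : Type) [Group G] (X : Type) [MeasurableSpace X] [MulAction G X]
    (μ : Measure X) : Prop :=
  ∀ g : G, MeasurePreserving (fun x : X => g • x) μ μ

/-- Essentially free action. -/
def FreeAction (G : Type) [Group G] (X : Type) [MeasurableSpace X] [MulAction G X]
    (μ : Measure X) : Prop :=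
  ∀ g : G, g ≠ 1 → μ {x : X | g • x = x} = 0

/-- Ergodic action of a group. -/
def ErgodicAction (G : Type) [Group G] (X : Type) [MeasurableSpace X] [MulAction G X]
    (μ : Measure X) : Prop :=
  ∀ A : Set X, MeasurableSet A → (∀ g : G, (fun x : X => g • x) ⁻¹' A = A) →
    μ A = 0 ∨ μ A = 1

/-- Ergodicity of the action of a subgroup. -/
def ErgodicSubgroup (G : Type) [Group G] (A : Subgroup G) (X : Type) [MeasurableSpace X]
    [MulAction G X] (μ : Measure X) : Prop :=
  ∀ s : Set X, MeasurableSet s → (∀ a ∈ A, (fun x : X => a • x) ⁻¹' s = s) →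
    μ s = 0 ∨ μ s = 1

/-- Irreducible action of a right-angled Artin group: for some identification of the group
with a `RAAG Δ`, every standard generator acts ergodically. -/
def IrreducibleAction (G : Type) [Group G] (X : Type) [MeasurableSpace X] [MulAction G X]
    (μ : Measure X) : Prop :=
  ∃ (n : ℕ) (Δ : SimpleGraph (Fin n)) (e : RAAG Δ ≃* G),
    ∀ v : Fin n, Ergodic (fun x : X => e (gen Δ v) • x) μ

/-- A measure space isomorphism (mod null sets): a measurable measure-preserving map
admitting an a.e. two-sided measurable inverse. -/
def MeasIso {A : Type} {B : Type} [MeasurableSpace A] [MeasurableSpace B]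
    (μ : Measure A) (ν : Measure B) (F : A → B) : Prop :=
  Measurable F ∧ MeasurePreserving F μ ν ∧
    ∃ F' : B → A, Measurable F' ∧ (∀ᵐ a ∂μ, F' (F a) = a) ∧ ∀ᵐ b ∂ν, F (F' b) = b

/-- Conjugacy of two actions through a given group isomorphism. -/
def ConjugateVia (G : Type) [Group G] (X : Type) [MeasurableSpace X] [MulAction G X]
    (H : Type) [Group H] (Y : Type) [MeasurableSpace Y] [MulAction H Y]
    (μ : Measure X) (ν : Measure Y) (α : G ≃* H) : Prop :=
  ∃ F : X → Y, MeasIso μ ν F ∧ ∀ g : G, ∀ᵐ x ∂μ, F (g • x) = α g • F x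

/-- Conjugacy of two actions. -/
def ConjugateActions (G : Type) [Group G] (X : Type) [MeasurableSpace X] [MulAction G X]
    (H : Type) [Group H] (Y : Type) [MeasurableSpace Y] [MulAction H Y]
    (μ : Measure X) (ν : Measure Y) : Prop :=
  ∃ α : G ≃* H, ConjugateVia G X H Y μ ν α

/-- Orbit equivalence of two actions. -/
def OrbitEquivalent (G : Type) [Group G] (X : Type) [MeasurableSpace X] [MulAction G X]
    (H : Type) [Group H] (Y : Type) [MeasurableSpace Y] [MulAction H Y]
    (μ : Measure X) (ν : Measure Y) : Prop :=
  ∃ F : X → Y, MeasIso μ ν F ∧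
    ∀ᵐ x ∂μ, F '' MulAction.orbit G x = MulAction.orbit H (F x)

/-- Measurable cocycle for an action, with values in a (discrete) group `H`. -/
def IsCocycle (G : Type) [Group G] (X : Type) [MeasurableSpace X] [MulAction G X]
    (H : Type) [Group H] (μ : Measure X) (c : G → X → H) : Prop :=
  (∀ (g : G) (h : H), MeasurableSet {x : X | c g x = h}) ∧
    ∀ g g' : G, ∀ᵐ x ∂μ, c (g * g') x = c g (g' • x) * c g' x

/-- Cohomology of cocycles. -/
def Cohomologous (G : Type) [Group G] (X : Type) [MeasurableSpace X] [MulAction G X]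
    (H : Type) [Group H] (μ : Measure X) (c c' : G → X → H) : Prop :=
  ∃ φ : X → H, (∀ h : H, MeasurableSet {x : X | φ x = h}) ∧
    ∀ g : G, ∀ᵐ x ∂μ, c' g x = φ (g • x) * c g x * (φ x)⁻¹

/-- A stable orbit equivalence between two actions: a measure-scaling Borel isomorphism
between positive measure subsets, matching orbits. -/
structure StableOE (G : Type) [Group G] (X : Type) [MeasurableSpace X] [MulAction G X]
    (H : Type) [Group H] (Y : Type) [MeasurableSpace Y] [MulAction H Y]
    (μ : Measure X) (ν : Measure Y) where
  U : Set X
  V : Set Y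
  measU : MeasurableSet U
  measV : MeasurableSet V
  posU : 0 < μ U
  posV : 0 < ν V
  toFun : X → Y
  invFun : Y → X
  meas_toFun : Measurable toFun
  meas_invFun : Measurable invFun
  maps : Set.MapsTo toFun U V
  maps_inv : Set.MapsTo invFun V U
  left_inv : ∀ x ∈ U, invFun (toFun x) = x
  right_inv : ∀ y ∈ V, toFun (invFun y) = y
  pushforward : ∀ B : Set Y, B ⊆ V → MeasurableSet B →
    (μ U)⁻¹ * μ (U ∩ toFun ⁻¹' B) = (ν V)⁻¹ * ν B
  orbit_eq : ∀ᵐ x ∂μ, x ∈ U →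
    toFun '' (MulAction.orbit G x ∩ U) = MulAction.orbit H (toFun x) ∩ V

namespace StableOE

variable {G : Type} [Group G] {X : Type} [MeasurableSpace X] [MulAction G X]
  {H : Type} [Group H] {Y : Type} [MeasurableSpace Y] [MulAction H Y]
  {μ : Measure X} {ν : Measure Y}

/-- The compression constant of a stable orbit equivalence. -/
noncomputable def kappa (f : StableOE G X H Y μ ν) : ℝ≥0∞ := ν f.V / μ f.U

/-- `c` is an SOE cocycle associated to the stable orbit equivalence `f`. -/
def IsSOECocycle (f : StableOE G X H Y μ ν) (c : G → X → H) : Prop :=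
  IsCocycle G X H μ c ∧
    ∃ p : X → X, Measurable p ∧
      (∀ᵐ x ∂μ, p x ∈ f.U ∧ p x ∈ MulAction.orbit G x) ∧
      ∀ g : G, ∀ᵐ x ∂μ, f.toFun (p (g • x)) = c g x • f.toFun (p x)

end StableOE

/-- Mildly mixing action. -/
def MildlyMixing (H : Type) [Group H] (Y : Type) [MeasurableSpace Y] [MulAction H Y]
    (ν : Measure Y) : Prop :=
  ∀ A : Set Y, MeasurableSet A → ν A ≠ 0 → ν A ≠ ν Set.univ →
    ∀ u : ℕ → H, Function.Injective u →
      0 < Filter.atTop.liminf fun n => ν (((u n • ·) '' A) ∆ A)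

/- ## Virtual conjugacy -/

/-- `(Z, qact, ρ)` together with `π : X → Z` is a model for the quotient of the action
`G ↷ (X, μ)` by the normal subgroup `F`, with the induced `G ⧸ F`-action. -/
def IsQuotientModel {G : Type} [Group G] (F : Subgroup G) [F.Normal]
    {X : Type} [MeasurableSpace X] [MulAction G X] (μ : Measure X)
    {Z : Type} [MeasurableSpace Z] (qact : G ⧸ F →* Equiv.Perm Z) (ρ : Measure Z)
    (π : X → Z) : Prop :=
  Measurable π ∧ Measure.map π μ = ρ ∧
    (∀ (g : G) (x : X), π (g • x) = qact (QuotientGroup.mk g) (π x)) ∧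
    ∀ x y : X, π x = π y ↔ ∃ f ∈ F, f • x = y

/-- The action `act : Q →* Perm Z` on `(Z, ρ)` is (isomorphic to) the action induced from the
action `act' : K →* Perm X'` of the finite-index subgroup `K` on `(X', μ')`. -/
def InducedFrom {Q : Type} [Group Q] (K : Subgroup Q)
    {Z : Type} [MeasurableSpace Z] (act : Q →* Equiv.Perm Z) (ρ : Measure Z)
    {X' : Type} [MeasurableSpace X'] (act' : ↥K →* Equiv.Perm X') (μ' : Measure X') : Prop :=
  letI : MeasurableSpace (Q ⧸ K) := ⊤
  ∃ σ : Q ⧸ K → Q, (∀ k : Q ⧸ K, (QuotientGroup.mk (σ k) : Q ⧸ K) = k) ∧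
    ∃ Φ : X' × (Q ⧸ K) → Z,
      MeasIso (Measure.sum fun k : Q ⧸ K =>
        (K.index : ℝ≥0∞)⁻¹ • Measure.map (fun x' : X' => (x', k)) μ') ρ Φ ∧
      ∀ (g : Q) (k : Q ⧸ K) (h : ↥K), (h : Q) = (σ (g • k))⁻¹ * g * σ k →
        ∀ᵐ x' ∂μ', Φ (act' h x', g • k) = act g (Φ (x', k))

/-- Data witnessing that two probability measure-preserving actions are virtually
conjugate. -/
structure VirtualConjugacyData
    (G₁ : Type) [Group G₁] (X₁ : Type) [MeasurableSpace X₁] [MulAction G₁ X₁] (μ₁ : Measure X₁)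
    (G₂ : Type) [Group G₂] (X₂ : Type) [MeasurableSpace X₂] [MulAction G₂ X₂] (μ₂ : Measure X₂) :
    Type 1 where
  F₁ : Subgroup G₁
  F₂ : Subgroup G₂
  normal₁ : F₁.Normal
  normal₂ : F₂.Normal
  finite₁ : Finite F₁
  finite₂ : Finite F₂
  K₁ : Subgroup (G₁ ⧸ F₁)
  K₂ : Subgroup (G₂ ⧸ F₂)
  finiteIndex₁ : K₁.FiniteIndex
  finiteIndex₂ : K₂.FiniteIndex
  X'₁ : Type
  X'₂ : Type
  mX'₁ : MeasurableSpace X'₁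
  mX'₂ : MeasurableSpace X'₂
  μ'₁ : Measure X'₁
  μ'₂ : Measure X'₂
  prob₁ : IsProbabilityMeasure μ'₁
  prob₂ : IsProbabilityMeasure μ'₂
  act₁ : ↥K₁ →* Equiv.Perm X'₁
  act₂ : ↥K₂ →* Equiv.Perm X'₂
  pmp₁ : ∀ k : ↥K₁, MeasurePreserving (act₁ k) μ'₁ μ'₁
  pmp₂ : ∀ k : ↥K₂, MeasurePreserving (act₂ k) μ'₂ μ'₂
  θ : ↥K₁ ≃* ↥K₂
  conjF : X'₁ → X'₂
  conjF_iso : MeasIso μ'₁ μ'₂ conjF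
  conjF_equivariant : ∀ k : ↥K₁, ∀ᵐ x ∂μ'₁, conjF (act₁ k x) = act₂ (θ k) (conjF x)
  Z₁ : Type
  Z₂ : Type
  mZ₁ : MeasurableSpace Z₁
  mZ₂ : MeasurableSpace Z₂
  ρ₁ : Measure Z₁
  ρ₂ : Measure Z₂
  qact₁ : G₁ ⧸ F₁ →* Equiv.Perm Z₁
  qact₂ : G₂ ⧸ F₂ →* Equiv.Perm Z₂
  qpmp₁ : ∀ g, MeasurePreserving (qact₁ g) ρ₁ ρ₁
  qpmp₂ : ∀ g, MeasurePreserving (qact₂ g) ρ₂ ρ₂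
  π₁ : X₁ → Z₁
  π₂ : X₂ → Z₂
  quot₁ : IsQuotientModel F₁ μ₁ qact₁ ρ₁ π₁
  quot₂ : IsQuotientModel F₂ μ₂ qact₂ ρ₂ π₂
  ind₁ : InducedFrom K₁ qact₁ ρ₁ act₁ μ'₁
  ind₂ : InducedFrom K₂ qact₂ ρ₂ act₂ μ'₂

/- ## Bernoulli actions -/

/-- The Bernoulli shift action of `G` on `G → A`. -/
instance bernoulliAction (G A : Type) [Group G] : MulAction G (G → A) where
  smul g x := fun h => x (g⁻¹ * h)
  one_smul x := funext fun h => by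
    show x (1⁻¹ * h) = x h
    rw [inv_one, one_mul]
  mul_smul g g' x := funext fun h => by
    show x ((g * g')⁻¹ * h) = x (g'⁻¹ * (g⁻¹ * h))
    rw [mul_inv_rev, mul_assoc]

/-- `μ` is the product (Bernoulli) measure on `G → A` with base `μ₀`:
it gives the product value to every cylinder set. -/
def IsBernoulliMeasure (G : Type) [Group G] {A : Type} [MeasurableSpace A]
    (μ₀ : Measure A) (μ : Measure (G → A)) : Prop :=
  ∀ (s : Finset G) (B : G → Set A), (∀ g : G, MeasurableSet (B g)) →
    μ {x : G → A | ∀ g ∈ s, x g ∈ B g} = ∏ g ∈ s, μ₀ (B g)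


/-- `𝓕`-ergodicity: every subgroup in the collection `𝓕` acts ergodically. -/
def FErgodic (G : Type) [Group G] (𝓕 : Set (Subgroup G)) (X : Type) [MeasurableSpace X]
    [MulAction G X] (μ : Measure X) : Prop :=
  ∀ A ∈ 𝓕, ErgodicSubgroup G A X μ

/-- Strong cocycle-rigidity of the pair `(G, 𝓕)`. -/
def StronglyCocycleRigid (G : Type) [Group G] (𝓕 : Set (Subgroup G)) : Prop :=
  ∀ (X : Type) [MeasurableSpace X] [StandardBorelSpace X] (μ : Measure X)
    (Y : Type) [MeasurableSpace Y] [StandardBorelSpace Y] (ν : Measure Y)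
    [IsProbabilityMeasure μ] [IsProbabilityMeasure ν]
    [MulAction G X] [MulAction G Y],
    PmpAction G X μ → FreeAction G X μ → ErgodicAction G X μ → FErgodic G 𝓕 X μ →
    PmpAction G Y ν → FreeAction G Y ν → ErgodicAction G Y ν → FErgodic G 𝓕 Y ν →
    ∀ f : StableOE G X G Y μ ν, ∀ c : G → X → G, f.IsSOECocycle c →
      ∃ α : G ≃* G, Cohomologous G X G μ c fun g _ => α g

section CocycleSuperrigidity

open Filter Topology Measure

section Bernoulli

variable {G : Type} [Group G]

/-- The shift by `g` on configurations `G → B`. -/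
def shift {B : Type} (g : G) (x : G → B) : G → B := fun h => x (g⁻¹ * h)

/-- The Bernoulli measure on `G → B` with base `β`. -/
noncomputable abbrev bern (G : Type) {B : Type} [MeasurableSpace B] (β : Measure B)
    [IsProbabilityMeasure β] : Measure (G → B) :=
  Measure.infinitePi fun _ : G => β

theorem shift_mul {B : Type} (g g' : G) (x : G → B) : shift (g * g') x = shift g (shift g' x) := by
  funext h
  simp [shift, mul_assoc]

theorem shift_inv_shift {B : Type} (g : G) (x : G → B) : shift g⁻¹ (shift g x) = x := by
  funext h
  simp [shift]

theorem shift_shift_inv {B : Type} (g : G) (x : G → B) : shift g (shift g⁻¹ x) = x := by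
  funext h
  simp [shift]

variable {B B' : Type} [MeasurableSpace B] [MeasurableSpace B']

theorem measurable_shift (g : G) : Measurable (shift (B := B) g) :=
  measurable_pi_lambda _ fun _ => measurable_pi_apply _

theorem measurePreserving_shift (β : Measure B) [IsProbabilityMeasure β] (g : G) :
    MeasurePreserving (shift (B := B) g) (bern G β) (bern G β) :=
  ⟨measurable_shift g,
    Measure.map_infinitePi_infinitePi_of_inj (P := fun _ : G => β)
      (f := fun h : G => g⁻¹ * h) (mul_right_injective _)⟩

theorem measurePreserving_bern_map {G : Type} {β : Measure B} [IsProbabilityMeasure β] {β' : Measure B'}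
    [IsProbabilityMeasure β'] {p : B → B'} (hp : MeasurePreserving p β β') :
    MeasurePreserving (fun (x : G → B) (g : G) => p (x g)) (bern G β) (bern G β') := by
  refine ⟨measurable_pi_lambda _ fun g => hp.measurable.comp (measurable_pi_apply g), ?_⟩
  have h := infinitePi_map_pi (fun _ : G => β) (f := fun _ => p) fun _ => hp.measurable
  rw [h]
  congr 1
  funext _
  exact hp.map_eq

theorem measurePreserving_bern_prod {G : Type} (β : Measure B) [IsProbabilityMeasure β] (β' : Measure B')
    [IsProbabilityMeasure β'] :
    MeasurePreserving (fun z : G → B × B' => ((fun g => (z g).1), (fun g => (z g).2)))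
      (bern G (β.prod β')) ((bern G β).prod (bern G β')) := by
  classical
  have hm : Measurable (fun z : G → B × B' => ((fun g => (z g).1), (fun g => (z g).2))) := by
    fun_prop
  refine ⟨hm, ?_⟩
  symm
  have hpi := fun (D : Type) [MeasurableSpace D] =>
    isPiSystem_squareCylinders (ι := G) (α := fun _ => D) (C := fun _ => {s | MeasurableSet s})
      (fun _ => MeasurableSpace.isPiSystem_measurableSet) (by simp)
  have huniv : ∀ (D : Type) [MeasurableSpace D],
      (Set.univ : Set (G → D)) ∈ squareCylinders fun _ => {s : Set D | MeasurableSet s} :=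
    fun D _ => ⟨∅, fun _ => Set.univ, by simp, by simp⟩
  have hfin : ∀ (D : Type) [MeasurableSpace D] (ν : Measure (G → D)) [IsProbabilityMeasure ν],
      ν.FiniteSpanningSetsIn (squareCylinders fun _ => {s : Set D | MeasurableSet s}) :=
    fun D _ ν _ => ⟨fun _ => Set.univ, fun _ => huniv D, fun _ => by finiteness, Set.iUnion_const _⟩
  refine Measure.prod_eq_generateFrom generateFrom_squareCylinders generateFrom_squareCylinders
    (hpi B) (hpi B') (hfin B _) (hfin B' _) ?_
  rintro _ ⟨s, t, ht, rfl⟩ _ ⟨s', t', ht', rfl⟩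
  simp only [Set.mem_pi, Set.mem_univ, true_implies, Set.mem_ofPred_eq] at ht ht'
  rw [Measure.map_apply hm ((MeasurableSet.pi s.countable_toSet fun i _ => ht i).prod
    (MeasurableSet.pi s'.countable_toSet fun i _ => ht' i))]
  have : (fun z : G → B × B' => ((fun g => (z g).1), (fun g => (z g).2))) ⁻¹'
      ((s : Set G).pi t ×ˢ (s' : Set G).pi t') =
      ((s ∪ s' : Finset G) : Set G).pi fun i =>
        (if i ∈ s then t i else Set.univ) ×ˢ (if i ∈ s' then t' i else Set.univ) := by
    ext z
    simp only [Set.mem_preimage, Set.mem_prod, Set.mem_pi, Finset.coe_union, Set.mem_union,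
      Finset.mem_coe]
    constructor
    · rintro ⟨h1, h2⟩ i _
      constructor
      · split_ifs with h
        · exact h1 i h
        · trivial
      · split_ifs with h
        · exact h2 i h
        · trivial
    · intro h
      refine ⟨fun i hi => ?_, fun i hi => ?_⟩
      · simpa [hi] using (h i (Or.inl hi)).1
      · simpa [hi] using (h i (Or.inr hi)).2
  rw [this, infinitePi_pi, infinitePi_pi _ fun i _ => ht i, infinitePi_pi _ fun i _ => ht' i]
  · simp only [Measure.prod_prod, Finset.prod_mul_distrib]
    congr 1
    · rw [← Finset.prod_subset Finset.subset_union_left]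
      · exact Finset.prod_congr rfl fun i hi => by simp [hi]
      · intro i _ hi
        simp [hi]
    · rw [← Finset.prod_subset Finset.subset_union_right]
      · exact Finset.prod_congr rfl fun i hi => by simp [hi]
      · intro i _ hi
        simp [hi]
  · intro i _
    refine MeasurableSet.prod ?_ ?_
    · split_ifs
      exacts [ht i, MeasurableSet.univ]
    · split_ifs
      exacts [ht' i, MeasurableSet.univ]

theorem IsBernoulliMeasure.eq_bern {μ₀ : Measure B} [IsProbabilityMeasure μ₀]
    {μ : Measure (G → B)} (h : IsBernoulliMeasure G μ₀ μ) : μ = bern G μ₀ :=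
  eq_infinitePi _ fun s t ht => h s t ht

end Bernoulli

section Mixing

theorem tendsto_measureReal_inter_of_piSystem {X κ : Type} [m : MeasurableSpace X]
    (μ : Measure X) [IsProbabilityMeasure μ] {C : Set (Set X)}
    (hgen : m = MeasurableSpace.generateFrom C) (hpi : IsPiSystem C) (l : Filter κ)
    (E : κ → Set X) (hE : ∀ k, MeasurableSet (E k)) (a : ℝ) (ha : ∀ k, μ.real (E k) = a)
    (hC : ∀ S ∈ C, Tendsto (fun k => μ.real (S ∩ E k)) l (𝓝 (μ.real S * a)))
    (S : Set X) (hS : MeasurableSet S) :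
    Tendsto (fun k => μ.real (S ∩ E k)) l (𝓝 (μ.real S * a)) := by
  induction S, hS using MeasurableSpace.induction_on_inter hgen hpi with
  | empty => simpa using tendsto_const_nhds
  | basic t ht => exact hC t ht
  | compl t ht ih =>
    have h1 : ∀ k, μ.real (tᶜ ∩ E k) = a - μ.real (t ∩ E k) := fun k => by
      have := measureReal_inter_add_sdiff (μ := μ) (s := E k) ht
      rw [Set.inter_comm, Set.sdiff_eq, Set.inter_comm (E k) tᶜ, ha] at this
      linarith
    simp only [h1, probReal_compl_eq_one_sub ht]
    have := tendsto_const_nhds (x := a) (f := l) |>.sub ih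
    convert this using 2
    ring
  | iUnion f hd hm ih =>
    have h1 : ∀ k, μ.real ((⋃ i, f i) ∩ E k) = ∑' i, μ.real (f i ∩ E k) := fun k => by
      rw [Set.iUnion_inter, measureReal_def, measure_iUnion
        (fun i j hij => (hd hij).mono Set.inter_subset_left Set.inter_subset_left)
        (fun i => (hm i).inter (hE k)), ENNReal.tsum_toReal_eq fun i => by finiteness]
      rfl
    have h2 : μ.real (⋃ i, f i) * a = ∑' i, μ.real (f i) * a := by
      rw [tsum_mul_right, measureReal_def, measure_iUnion hd hm,
        ENNReal.tsum_toReal_eq fun i => by finiteness]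
      rfl
    simp only [h1, h2]
    refine tendsto_tsum_of_dominated_convergence (bound := fun i => μ.real (f i)) ?_ ih ?_
    · refine ENNReal.summable_toReal ?_
      rw [← measure_iUnion hd hm]
      finiteness
    · refine Eventually.of_forall fun k i => ?_
      rw [Real.norm_of_nonneg measureReal_nonneg]
      exact measureReal_mono Set.inter_subset_left

variable {G : Type} [Group G] {B : Type} [MeasurableSpace B]

theorem bern_mixing (β : Measure B) [IsProbabilityMeasure β] (K : Subgroup G)
    (S T : Set (G → B)) (hS : MeasurableSet S) (hT : MeasurableSet T) :
    Tendsto (fun k : K => (bern G β).real (S ∩ shift (k : G) ⁻¹' T)) cofinite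
      (𝓝 ((bern G β).real S * (bern G β).real T)) := by
  classical
  have hgen := (generateFrom_squareCylinders (ι := G) (α := fun _ => B)).symm
  have hpi := isPiSystem_squareCylinders (ι := G) (α := fun _ => B)
    (C := fun _ => {s | MeasurableSet s}) (fun _ => MeasurableSpace.isPiSystem_measurableSet) (by simp)
  have hmeas : ∀ D ∈ squareCylinders (fun _ : G => {s : Set B | MeasurableSet s}),
      MeasurableSet D := fun D hD => hgen ▸ MeasurableSpace.measurableSet_generateFrom hD
  have hpre : ∀ (g : G) (D : Set (G → B)), MeasurableSet D →
      (bern G β).real (shift g ⁻¹' D) = (bern G β).real D := fun g D hD =>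
    (measurePreserving_shift β g).measureReal_preimage hD.nullMeasurableSet
  have hbox : ∀ S ∈ squareCylinders (fun _ : G => {s : Set B | MeasurableSet s}),
      ∀ T ∈ squareCylinders (fun _ : G => {s : Set B | MeasurableSet s}),
      Tendsto (fun k : K => (bern G β).real (S ∩ shift (k : G) ⁻¹' T)) cofinite
        (𝓝 ((bern G β).real S * (bern G β).real T)) := by
    rintro _ ⟨s, t, ht, rfl⟩ _ ⟨s', t', ht', rfl⟩
    simp only [Set.mem_pi, Set.mem_univ, true_implies, Set.mem_ofPred_eq] at ht ht'
    refine tendsto_const_nhds.congr' ?_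
    have hbad : {k : K | ∃ i ∈ s', ∃ j ∈ s, (k : G)⁻¹ * i = j}.Finite := by
      refine Set.Finite.subset (s := (Subtype.val ⁻¹'
        ((s' ×ˢ s).image fun p => p.1 * p.2⁻¹ : Finset G) : Set K))
        ((Finset.finite_toSet _).preimage Subtype.val_injective.injOn) ?_
      rintro k ⟨i, hi, j, hj, rfl⟩
      simp only [Set.mem_preimage, Finset.mem_coe, Finset.mem_image, Finset.mem_product]
      exact ⟨(i, (k : G)⁻¹ * i), ⟨hi, hj⟩, by simp⟩
    filter_upwards [hbad.compl_mem_cofinite] with k hk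
    have hdisj : Disjoint s (s'.image fun i => (k : G)⁻¹ * i) := by
      rw [Finset.disjoint_left]
      intro j hj hj'
      obtain ⟨i, hi, rfl⟩ := Finset.mem_image.1 hj'
      exact hk ⟨i, hi, _, hj, rfl⟩
    have heq : (s : Set G).pi t ∩ shift (k : G) ⁻¹' (s' : Set G).pi t' =
        ((s ∪ s'.image fun i => (k : G)⁻¹ * i : Finset G) : Set G).pi
          fun i => if i ∈ s then t i else t' (k * i) := by
      ext x
      simp only [Set.mem_inter_iff, Set.mem_pi, Set.mem_preimage, Finset.coe_union,
        Finset.coe_image, Set.mem_union, Finset.mem_coe, Set.mem_image, shift]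
      constructor
      · rintro ⟨h1, h2⟩ i hi
        split_ifs with h
        · exact h1 i h
        · obtain ⟨j, hj, rfl⟩ := hi.resolve_left h
          rw [mul_inv_cancel_left]
          exact h2 j hj
      · intro h
        refine ⟨fun i hi => by simpa [hi] using h i (Or.inl hi), fun i hi => ?_⟩
        have h3 := h _ (Or.inr ⟨i, hi, rfl⟩)
        rw [if_neg fun h' => hk ⟨i, hi, _, h', rfl⟩, mul_inv_cancel_left] at h3
        exact h3
    rw [heq, measureReal_def, measureReal_def, measureReal_def,
      infinitePi_pi _ fun i _ => ht i, infinitePi_pi _ fun i _ => ht' i, infinitePi_pi,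
      Finset.prod_union hdisj, ENNReal.toReal_mul]
    · congr 2
      · exact Finset.prod_congr rfl fun i hi => by simp [hi]
      · rw [Finset.prod_image fun _ _ _ _ h => mul_left_cancel h]
        refine Finset.prod_congr rfl fun i hi => ?_
        rw [if_neg fun h' => hk ⟨i, hi, _, h', rfl⟩, mul_inv_cancel_left]
    · intro i _
      split_ifs
      exacts [ht i, ht' _]
  have h1 : ∀ S, MeasurableSet S →
      ∀ T ∈ squareCylinders (fun _ : G => {s : Set B | MeasurableSet s}),
      Tendsto (fun k : K => (bern G β).real (S ∩ shift (k : G) ⁻¹' T)) cofinite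
        (𝓝 ((bern G β).real S * (bern G β).real T)) := fun S hS T hT =>
    tendsto_measureReal_inter_of_piSystem _ hgen hpi _ _
      (fun k => measurable_shift _ (hmeas T hT)) _ (fun k => hpre _ _ (hmeas T hT))
      (fun S hS => hbox S hS T hT) S hS
  have hflip : ∀ (k : K) (T : Set (G → B)), MeasurableSet T →
      (bern G β).real (S ∩ shift (k : G) ⁻¹' T) =
      (bern G β).real (T ∩ shift (k : G)⁻¹ ⁻¹' S) := fun k T hT => by
    rw [← hpre (k : G)⁻¹ _ (hS.inter (measurable_shift _ hT)), Set.preimage_inter,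
      ← Set.preimage_comp, Set.inter_comm]
    congr 2
    ext x
    simp [shift_shift_inv]
  have h2 := tendsto_measureReal_inter_of_piSystem (bern G β) hgen hpi cofinite
      (fun k : K => shift (k : G)⁻¹ ⁻¹' S)
      (fun k => measurable_shift _ hS) _ (fun k => hpre _ _ hS)
      (fun T hT => by
        simp only [← hflip _ T (hmeas T hT)]
        rw [mul_comm]
        exact h1 S hS T hT) T hT
  simp only [hflip _ T hT]
  rw [mul_comm]
  exact h2

/-- A family of transformations is jointly ergodic if every set invariant, up to null sets, under
all of them is trivial. -/
def JointlyErgodic {ι X : Type} [MeasurableSpace X] (T : ι → X → X) (μ : Measure X) : Prop :=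
  ∀ S : Set X, MeasurableSet S → (∀ i, ∀ᵐ x ∂μ, (T i x ∈ S ↔ x ∈ S)) → μ S = 0 ∨ μ S = 1

/-- A family of transformations indexed by `G` is Bernoulli-like if it is a factor of a Bernoulli
shift. -/
def BernoulliFactor {X : Type} [MeasurableSpace X] (T : G → X → X) (μ : Measure X) : Prop :=
  ∃ (B : Type) (_ : MeasurableSpace B) (β : Measure B) (_ : IsProbabilityMeasure β)
    (π : (G → B) → X), MeasurePreserving π (bern G β) μ ∧ ∀ g z, π (shift g z) = T g (π z)

theorem bernoulliFactor_shift (β : Measure B) [IsProbabilityMeasure β] :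
    BernoulliFactor (G := G) shift (bern G β) :=
  ⟨B, _, β, _, id, MeasurePreserving.id _, fun _ _ => rfl⟩

theorem BernoulliFactor.prod {X Y : Type} [MeasurableSpace X] [MeasurableSpace Y]
    {T : G → X → X} {μ : Measure X} {T' : G → Y → Y} {ν : Measure Y} [SFinite ν]
    (h : BernoulliFactor T μ) (h' : BernoulliFactor T' ν) :
    BernoulliFactor (fun g (p : X × Y) => (T g p.1, T' g p.2)) (μ.prod ν) := by
  obtain ⟨B, _, β, _, π, hπ, he⟩ := h
  obtain ⟨B', _, β', _, π', hπ', he'⟩ := h'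
  refine ⟨B × B', _, β.prod β', inferInstance, _,
    (hπ.prod hπ').comp (measurePreserving_bern_prod β β'), fun g z => ?_⟩
  simp only [Function.comp, Prod.map, ← he, ← he']
  rfl

theorem BernoulliFactor.jointlyErgodic {X : Type} [MeasurableSpace X] {T : G → X → X}
    {μ : Measure X} (h : BernoulliFactor T μ) (K : Subgroup G) (hK : (K : Set G).Infinite) :
    JointlyErgodic (fun k : K => T k) μ := by
  obtain ⟨B, _, β, _, π, hπ, he⟩ := h
  intro S hS hinv
  have hinf : Infinite K := hK.to_subtype
  have hmix := bern_mixing β K (π ⁻¹' S) (π ⁻¹' S) (hπ.measurable hS) (hπ.measurable hS)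
  have hc : ∀ k : K, (bern G β).real (π ⁻¹' S ∩ shift (k : G) ⁻¹' (π ⁻¹' S)) =
      (bern G β).real (π ⁻¹' S) := fun k => by
    refine measureReal_congr ?_
    filter_upwards [hπ.quasiMeasurePreserving.ae (hinv k)] with z hz
    refine propext ⟨fun h => h.1, fun h => ⟨h, ?_⟩⟩
    change π (shift (k : G) z) ∈ S
    rw [he]
    exact hz.2 h
  simp only [hc] at hmix
  have hsq := tendsto_nhds_unique tendsto_const_nhds hmix
  have hr : (bern G β).real (π ⁻¹' S) = μ.real S :=
    hπ.measureReal_preimage hS.nullMeasurableSet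
  have hμ : IsProbabilityMeasure μ :=
    hπ.map_eq ▸ Measure.isProbabilityMeasure_map hπ.measurable.aemeasurable
  rw [hr] at hsq
  have : μ.real S = 0 ∨ μ.real S = 1 := by
    rcases eq_or_ne (μ.real S) 0 with h0 | h0
    · exact Or.inl h0
    · exact Or.inr (mul_left_cancel₀ h0 (by linarith))
  rcases this with h0 | h1
  · left
    rwa [measureReal_eq_zero_iff] at h0
  · right
    rw [measureReal_def, ENNReal.toReal_eq_one_iff] at h1
    exact h1

end Mixing

section Nonamenable

/-- On a nonamenable group, an almost invariant finitely additive measure has small mass. -/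
theorem exists_finset_almost_invariant_le {Λ : Type} [Group Λ] (hΛ : ¬ IsAmenable Λ) {ε : ℝ}
    (hε : 0 < ε) :
    ∃ (F : Finset Λ) (κ : ℝ), 0 < κ ∧ ∀ m : Set Λ → ℝ, (∀ A, 0 ≤ m A) → (∀ A, m A ≤ 1) →
      (∀ A B, Disjoint A B → m (A ∪ B) = m A + m B) →
      (∀ g ∈ F, ∀ A, m ((g * ·) '' A) ≤ m A + κ) → m Set.univ ≤ ε := by
  classical
  by_contra hcon
  push Not at hcon
  have hex : ∀ p : Finset Λ × ℕ, ∃ m : Set Λ → ℝ, (∀ A, 0 ≤ m A) ∧ (∀ A, m A ≤ 1) ∧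
      (∀ A B, Disjoint A B → m (A ∪ B) = m A + m B) ∧
      (∀ g ∈ p.1, ∀ A, m ((g * ·) '' A) ≤ m A + 1 / ((p.2 : ℝ) + 1)) ∧ ε < m Set.univ :=
    fun p => hcon p.1 (1 / ((p.2 : ℝ) + 1)) (by positivity)
  choose m h0 h1 hadd hinv hmass using hex
  let U : Ultrafilter (Finset Λ × ℕ) := Ultrafilter.of atTop
  have hU : (U : Filter (Finset Λ × ℕ)) ≤ atTop := Ultrafilter.of_le _
  have hlim : ∀ A : Set Λ, ∃ x, Tendsto (fun p => m p A) U (𝓝 x) := fun A => by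
    obtain ⟨x, -, hx⟩ := (isCompact_Icc (a := (0 : ℝ)) (b := 1)).ultrafilter_le_nhds
      (U.map fun p => m p A) (le_principal_iff.2
        (mem_map.2 (univ_mem' fun p => ⟨h0 p A, h1 p A⟩)))
    exact ⟨x, hx⟩
  choose M hM using hlim
  have hM0 : ∀ A, 0 ≤ M A := fun A => ge_of_tendsto' (hM A) fun p => h0 p A
  have hMadd : ∀ A B, Disjoint A B → M (A ∪ B) = M A + M B := fun A B hAB =>
    tendsto_nhds_unique (hM _) (by simpa only [hadd _ A B hAB] using (hM A).add (hM B))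
  have hMmass : ε ≤ M Set.univ := ge_of_tendsto' (hM _) fun p => (hmass p).le
  have hle : ∀ (g : Λ) (A : Set Λ), M ((g * ·) '' A) ≤ M A := fun g A => by
    have hz : Tendsto (fun p : Finset Λ × ℕ => 1 / ((p.2 : ℝ) + 1)) U (𝓝 0) := by
      refine (tendsto_one_div_add_atTop_nhds_zero_nat.comp ?_).mono_left hU
      rw [← prod_atTop_atTop_eq]
      exact tendsto_snd
    have hs := (hM A).add hz
    rw [add_zero] at hs
    refine le_of_tendsto_of_tendsto (hM _) hs ?_
    have : ∀ᶠ p : Finset Λ × ℕ in atTop, g ∈ p.1 := by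
      filter_upwards [eventually_ge_atTop (({g} : Finset Λ), 0)] with p hp
      exact hp.1 (Finset.mem_singleton_self g)
    filter_upwards [hU this] with p hp
    exact hinv p g hp A
  have hMpos : 0 < M Set.univ := hε.trans_le hMmass
  have hinv' : ∀ (g : Λ) (A : Set Λ), M ((g * ·) '' A) = M A := fun g A => by
    refine le_antisymm (hle g A) ?_
    have := hle g⁻¹ ((g * ·) '' A)
    rwa [Set.image_image, show (fun x => g⁻¹ * (g * x)) = id from by ext; simp,
      Set.image_id] at this
  refine hΛ ⟨fun A => M A / M Set.univ, div_self hMpos.ne',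
    fun A => div_nonneg (hM0 A) hMpos.le, fun A B hAB => ?_, fun g A => ?_⟩
  · show M _ / _ = M _ / _ + M _ / _
    rw [hMadd A B hAB, add_div]
  · show M _ / _ = M _ / _
    rw [hinv']

end Nonamenable

section Fourier

/-- The Haar probability measure on the circle. -/
noncomputable abbrev circleMeasure : Measure (AddCircle (1 : ℝ)) := AddCircle.haarAddCircle

theorem exists_measurePreserving_circle {B : Type} [MeasurableSpace B] [StandardBorelSpace B]
    (β : Measure B) [IsProbabilityMeasure β] :
    ∃ p : AddCircle (1 : ℝ) → B, MeasurePreserving p circleMeasure β := by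
  have : Nonempty B := nonempty_of_isProbabilityMeasure β
  obtain ⟨f, hf, hfβ⟩ := β.exists_measurable_map_eq
  have hv : (volume : Measure (AddCircle (1 : ℝ))) = circleMeasure := by
    rw [AddCircle.volume_eq_smul_haarAddCircle]
    simp
  have h1 := AddCircle.measurePreserving_equivIoc 1 (a := (0 : ℝ))
  rw [hv] at h1
  let j : Set.Ioc (0 : ℝ) (0 + 1) → unitInterval := fun x => ⟨x, x.2.1.le, by simpa using x.2.2⟩
  have hj : MeasurePreserving j (Measure.comap Subtype.val volume) volume := by
    refine ⟨by fun_prop, ?_⟩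
    ext s hs
    have hI : MeasurableSet (Set.Icc (0 : ℝ) 1) := measurableSet_Icc
    rw [Measure.map_apply (by fun_prop) hs,
      comap_apply _ Subtype.val_injective
        (fun t ht => measurableSet_Ioc.subtype_image ht) _ ((by fun_prop : Measurable j) hs),
      show (volume : Measure unitInterval) s = volume (Subtype.val '' s) from
        comap_apply _ Subtype.val_injective (fun t ht => hI.subtype_image ht) _ hs]
    refine measure_congr ?_
    have : ∀ᵐ x : ℝ, x ≠ 0 := by simp [ae_iff]
    filter_upwards [this] with x hx
    refine propext ⟨?_, ?_⟩
    · rintro ⟨y, hy, rfl⟩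
      exact ⟨j y, hy, rfl⟩
    · rintro ⟨y, hy, rfl⟩
      exact ⟨⟨y, lt_of_le_of_ne y.2.1 (Ne.symm hx), by simpa using y.2.2⟩, hy, rfl⟩
  exact ⟨f ∘ j ∘ AddCircle.equivIoc 1 0, (⟨hf, hfβ⟩ : MeasurePreserving f volume β).comp
    (hj.comp h1)⟩

variable {G : Type}

/-- The character of the torus `G → ℝ/ℤ` with exponents `k`. -/
noncomputable def chr (k : G →₀ ℤ) : C(G → AddCircle (1 : ℝ), ℂ) where
  toFun x := (AddCircle.toCircle (k.sum fun γ n => n • x γ) : ℂ)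
  continuous_toFun := by
    unfold Finsupp.sum
    fun_prop

theorem chr_zero : chr (0 : G →₀ ℤ) = 1 := by
  ext x
  simp [chr]

theorem chr_add (k l : G →₀ ℤ) : chr (k + l) = chr k * chr l := by
  classical
  ext x
  simp only [chr, ContinuousMap.coe_mk, ContinuousMap.mul_apply]
  rw [Finsupp.sum_add_index' (by simp) (by intros; rw [add_zsmul]), AddCircle.toCircle_add,
    Circle.coe_mul]

theorem norm_chr (k : G →₀ ℤ) (x) : ‖chr k x‖ = 1 :=
  Circle.norm_coe _

theorem chr_neg (k : G →₀ ℤ) (x) : chr (-k) x = starRingEnd ℂ (chr k x) := by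
  simp only [chr, ContinuousMap.coe_mk]
  rw [Finsupp.sum_neg_index (by simp)]
  simp only [Finsupp.sum, neg_smul, Finset.sum_neg_distrib, AddCircle.toCircle_neg,
    Circle.coe_inv_eq_conj]

theorem chr_apply_add (k : G →₀ ℤ) (x y : G → AddCircle (1 : ℝ)) :
    chr k (x + y) = chr k x * chr k y := by
  simp only [chr, ContinuousMap.coe_mk, Pi.add_apply, smul_add]
  rw [Finsupp.sum_add, AddCircle.toCircle_add, Circle.coe_mul]

theorem chr_single (γ : G) (n : ℤ) (x : G → AddCircle (1 : ℝ)) :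
    chr (Finsupp.single γ n) x = fourier n (x γ) := by
  simp [chr, fourier_apply]

theorem chr_shift [Group G] (k : G →₀ ℤ) (g : G) (x : G → AddCircle (1 : ℝ)) :
    chr k (shift g⁻¹ x) = chr (k.equivMapDomain (Equiv.mulLeft g)) x := by
  simp only [chr, ContinuousMap.coe_mk]
  rw [Finsupp.sum_equivMapDomain]
  simp [shift]

theorem integral_chr {k : G →₀ ℤ} (hk : k ≠ 0) :
    ∫ x, chr k x ∂(bern G circleMeasure) = 0 := by
  classical
  obtain ⟨γ, hγ⟩ := Finsupp.ne_iff.1 hk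
  let a : G → AddCircle (1 : ℝ) := Pi.single γ (((1 : ℝ) / 2 / (k γ : ℝ) : ℝ) : AddCircle (1 : ℝ))
  have ha : chr k a = -1 := by
    have h := fourier_add_half_inv_index (T := 1) (n := k γ) hγ one_pos 0
    simp only [zero_add, fourier_eval_zero] at h
    rw [← h, fourier_apply]
    simp only [chr, ContinuousMap.coe_mk, a]
    congr 2
    rw [Finsupp.sum, Finset.sum_eq_single γ]
    · simp
    · intro b _ hb
      simp [hb]
    · intro h
      rw [Finsupp.notMem_support_iff.1 h]
      simp
  have hmp : MeasurePreserving (fun x : G → AddCircle (1 : ℝ) => a + x) (bern G circleMeasure)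
      (bern G circleMeasure) := by
    refine ⟨by fun_prop, ?_⟩
    have h := infinitePi_map_pi (fun _ : G => circleMeasure) (f := fun g y => a g + y)
      fun g => measurable_const_add _
    simp only [map_add_left_eq_self] at h
    exact h
  have h1 : ∫ x, chr k (a + x) ∂(bern G circleMeasure) = ∫ x, chr k x ∂(bern G circleMeasure) :=
    hmp.integral_comp (MeasurableEquiv.addLeft a).measurableEmbedding _
  simp only [chr_apply_add, ha, neg_mul, one_mul, integral_neg] at h1
  linear_combination -(1 / 2 : ℂ) * h1

theorem span_chr_closure_eq_top :
    (Submodule.span ℂ (Set.range (chr (G := G)))).topologicalClosure = ⊤ := by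
  classical
  let S : StarSubalgebra ℂ C(G → AddCircle (1 : ℝ), ℂ) :=
    { toSubalgebra := Algebra.adjoin ℂ (Set.range chr)
      star_mem' := by
        change Algebra.adjoin ℂ (Set.range chr) ≤ star (Algebra.adjoin ℂ (Set.range chr))
        refine Algebra.adjoin_le ?_
        rintro _ ⟨n, rfl⟩
        refine Algebra.subset_adjoin ⟨-n, ?_⟩
        ext1 x
        simp only [chr_neg, starRingEnd_apply, ContinuousMap.star_apply] }
  have hS : S.toSubalgebra.toSubmodule = Submodule.span ℂ (Set.range (chr (G := G))) := by
    apply Algebra.adjoin_eq_span_of_subset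
    refine .trans (fun x ↦ Submonoid.closure_induction (fun _ ↦ id) ⟨0, chr_zero⟩ ?_)
      Submodule.subset_span
    rintro _ _ _ _ ⟨m, rfl⟩ ⟨n, rfl⟩
    exact ⟨m + n, chr_add m n⟩
  have hsep : S.SeparatesPoints := by
    intro x y hxy
    rw [Ne, funext_iff, not_forall] at hxy
    obtain ⟨i, hi⟩ := hxy
    refine ⟨_, ⟨chr (Finsupp.single i 1), Algebra.subset_adjoin ⟨Finsupp.single i 1, rfl⟩, rfl⟩, ?_⟩
    dsimp only
    rw [chr_single, chr_single, fourier_one, fourier_one]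
    intro h
    exact hi (AddCircle.injective_toCircle one_ne_zero (Circle.coe_injective h))
  rw [← hS]
  exact congr_arg (Subalgebra.toSubmodule <| StarSubalgebra.toSubalgebra ·)
    (ContinuousMap.starSubalgebra_topologicalClosure_eq_top_of_separatesPoints _ hsep)

variable [Countable G]

/-- The characters as elements of `L²`. -/
noncomputable abbrev chrLp (k : G →₀ ℤ) : Lp ℂ 2 (bern G circleMeasure) :=
  ContinuousMap.toLp (E := ℂ) 2 (bern G circleMeasure) ℂ (chr k)

theorem orthonormal_chrLp : Orthonormal ℂ (chrLp (G := G)) := by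
  classical
  rw [orthonormal_iff_ite]
  intro m n
  rw [ContinuousMap.inner_toLp]
  simp only [← chr_neg]
  have : ∀ x, chr n x * chr (-m) x = chr (n - m) x := fun x => by
    rw [sub_eq_add_neg, chr_add]
    rfl
  simp only [this]
  split_ifs with h
  · simp [h, chr_zero]
  · exact integral_chr (sub_ne_zero.2 (Ne.symm h))

theorem span_chrLp_closure_eq_top :
    (Submodule.span ℂ (Set.range (chrLp (G := G)))).topologicalClosure = ⊤ := by
  simpa only [Submodule.map_span, ContinuousLinearMap.coe_coe, ← Set.range_comp,
    Function.comp_def] using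
    (ContinuousMap.toLp_denseRange ℂ (bern G circleMeasure) ℂ
      (p := 2) (by simp)).topologicalClosure_map_submodule span_chr_closure_eq_top

/-- Parseval's identity for the characters of the torus. -/
theorem tsum_enorm_integral_chr (v : (G → AddCircle (1 : ℝ)) → ℝ)
    (hv : MemLp v 2 (bern G circleMeasure)) :
    ∑' k : G →₀ ℤ, ‖∫ x, (v x : ℂ) * chr k x ∂(bern G circleMeasure)‖ₑ ^ 2 =
      ∫⁻ x, ‖v x‖ₑ ^ 2 ∂(bern G circleMeasure) := by
  have hvc : MemLp (fun x => (v x : ℂ)) 2 (bern G circleMeasure) := hv.ofReal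
  let V : Lp ℂ 2 (bern G circleMeasure) := hvc.toLp _
  let b := HilbertBasis.mk (orthonormal_chrLp (G := G)) span_chrLp_closure_eq_top.ge
  have hb : ∀ k, b k = chrLp k := fun k => by simp [b]
  have hi : ∀ k, ‖inner ℂ (b k) V‖ₑ = ‖∫ x, (v x : ℂ) * chr k x ∂(bern G circleMeasure)‖ₑ := by
    intro k
    rw [hb, L2.inner_def]
    have : ∫ a, inner ℂ ((chrLp k : Lp ℂ 2 (bern G circleMeasure)) a) (V a) ∂(bern G circleMeasure)
        = starRingEnd ℂ (∫ x, (v x : ℂ) * chr k x ∂(bern G circleMeasure)) := by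
      rw [← integral_conj]
      refine integral_congr_ae ?_
      filter_upwards [ContinuousMap.coeFn_toLp (𝕜 := ℂ) (p := 2) (bern G circleMeasure) (chr k),
        hvc.coeFn_toLp] with x h1 h2
      rw [h1, h2]
      simp
    rw [this, RCLike.enorm_conj]
  have hs := b.hasSum_inner_mul_inner V V
  have hs2 : HasSum (fun k => ‖inner ℂ (b k) V‖ ^ 2) (‖V‖ ^ 2) := by
    have h3 := Complex.hasSum_re hs
    convert h3 using 1
    · funext k
      rw [← inner_conj_symm, Complex.mul_conj, Complex.ofReal_re, Complex.normSq_eq_norm_sq,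
        RCLike.norm_conj]
    · rw [inner_self_eq_norm_sq_to_K]
      norm_cast
  have hV : ENNReal.ofReal (‖V‖ ^ 2) = ∫⁻ x, ‖v x‖ₑ ^ 2 ∂(bern G circleMeasure) := by
    rw [Lp.norm_def, ENNReal.ofReal_pow (by positivity), ENNReal.ofReal_toReal (Lp.eLpNorm_ne_top V),
      eLpNorm_congr_ae hvc.coeFn_toLp, eLpNorm_eq_lintegral_rpow_enorm_toReal (by simp) (by simp)]
    simp only [ENNReal.toReal_ofNat, ENNReal.rpow_ofNat, one_div]
    rw [← ENNReal.rpow_natCast, ← ENNReal.rpow_mul]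
    simp [enorm_eq_nnnorm, Complex.nnnorm_real]
  rw [← hV, ← hs2.tsum_eq, ENNReal.ofReal_tsum_of_nonneg (by intros; positivity) hs2.summable]
  refine tsum_congr fun k => ?_
  rw [← hi, ENNReal.ofReal_pow (by positivity), ofReal_norm]

end Fourier

section SpectralGap

/-- The indicator function of a fibre of `φ`. -/
noncomputable def fibreInd {W H : Type} (φ : W → H) (h : H) : W → ℝ :=
  (φ ⁻¹' {h}).indicator 1

theorem fibreInd_of_eq {W H : Type} {φ : W → H} {h : H} {w : W} (hw : φ w = h) :
    fibreInd φ h w = 1 := by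
  simp [fibreInd, hw]

theorem fibreInd_of_ne {W H : Type} {φ : W → H} {h : H} {w : W} (hw : φ w ≠ h) :
    fibreInd φ h w = 0 := by
  simp [fibreInd, hw]

theorem fibreInd_congr {W W' H H' : Type} {φ : W → H} {φ' : W' → H'} {h : H} {h' : H'} {w : W}
    {w' : W'} (hw : φ w = h ↔ φ' w' = h') : fibreInd φ h w = fibreInd φ' h' w' := by
  by_cases H : φ w = h
  · rw [fibreInd_of_eq H, fibreInd_of_eq (hw.1 H)]
  · rw [fibreInd_of_ne H, fibreInd_of_ne fun h => H (hw.2 h)]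

theorem tsum_enorm_fibreInd {W H : Type} (φ : W → H) (w : W) :
    ∑' h, ‖fibreInd φ h w‖ₑ ^ 2 = 1 := by
  rw [tsum_eq_single (φ w) fun h hh => by simp [fibreInd_of_ne hh.symm], fibreInd_of_eq rfl]
  simp

theorem tsum_enorm_fibreInd_sub_le {W H : Type} (φ φ' : W → H) (w : W) :
    ∑' h, ‖fibreInd φ h w - fibreInd φ' h w‖ₑ ^ 2 ≤ {w | φ w ≠ φ' w}.indicator 2 w := by
  classical
  by_cases hw : φ w = φ' w
  · have : ∀ h, fibreInd φ h w = fibreInd φ' h w := fun h => fibreInd_congr (by rw [hw])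
    simp [this]
  · rw [Set.indicator_of_mem (by exact hw), tsum_eq_sum (s := {φ w, φ' w}), Finset.sum_pair hw,
      fibreInd_of_eq rfl, fibreInd_of_eq rfl, fibreInd_of_ne hw, fibreInd_of_ne (Ne.symm hw)]
    · simp [one_add_one_eq_two]
    · intro h hh
      simp only [Finset.mem_insert, Finset.mem_singleton, not_or] at hh
      rw [fibreInd_of_ne (Ne.symm hh.1), fibreInd_of_ne (Ne.symm hh.2)]
      simp

theorem enorm_sq_le (a b : ℂ) {η : ℝ} (hη : 0 < η) :
    ‖a‖ₑ ^ 2 ≤ ENNReal.ofReal (1 + η) * ‖b‖ₑ ^ 2 + ENNReal.ofReal (1 + η⁻¹) * ‖a - b‖ₑ ^ 2 := by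
  simp only [← ofReal_norm]
  rw [← ENNReal.ofReal_pow (by positivity), ← ENNReal.ofReal_pow (by positivity),
    ← ENNReal.ofReal_pow (by positivity), ← ENNReal.ofReal_mul (by positivity),
    ← ENNReal.ofReal_mul (by positivity), ← ENNReal.ofReal_add (by positivity) (by positivity)]
  refine ENNReal.ofReal_le_ofReal ?_
  have h1 : ‖a‖ ≤ ‖b‖ + ‖a - b‖ := by
    simpa using norm_add_le b (a - b)
  set p := ‖b‖
  set q := ‖a - b‖
  have h2 : ‖a‖ ^ 2 ≤ (p + q) ^ 2 := by gcongr
  have h3 : 0 ≤ (η * p - q) ^ 2 * η⁻¹ := by positivity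
  have h4 : (η * p - q) ^ 2 * η⁻¹ = η * p ^ 2 - 2 * p * q + η⁻¹ * q ^ 2 := by
    field_simp
    ring
  nlinarith

variable {G H : Type}

local notation "𝕋" => (G → AddCircle (1 : ℝ))

/-- The spectral weight at the character `k` of a function with countably many values. -/
noncomputable def specWeight (φ : 𝕋 → H) (k : G →₀ ℤ) : ℝ≥0∞ :=
  ∑' h, ‖∫ x, (fibreInd φ h x : ℂ) * chr k x ∂(bern G circleMeasure)‖ₑ ^ 2

/-- The spectral weight at the character `k` of the difference of two functions. -/
noncomputable def specDist (φ φ' : 𝕋 → H) (k : G →₀ ℤ) : ℝ≥0∞ :=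
  ∑' h, ‖∫ x, ((fibreInd φ h x - fibreInd φ' h x : ℝ) : ℂ) * chr k x
    ∂(bern G circleMeasure)‖ₑ ^ 2

theorem specWeight_conj [Group H] (φ : 𝕋 → H) (a b : H) (k : G →₀ ℤ) :
    specWeight (fun x => a * φ x * b⁻¹) k = specWeight φ k := by
  unfold specWeight
  rw [← ((Equiv.mulLeft a).trans (Equiv.mulRight b⁻¹)).tsum_eq]
  refine tsum_congr fun h => ?_
  have : ∀ x, fibreInd (fun x => a * φ x * b⁻¹)
      (((Equiv.mulLeft a).trans (Equiv.mulRight b⁻¹)) h) x = fibreInd φ h x :=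
    fun x => fibreInd_congr (by simp)
  simp only [this]

theorem specWeight_shift [Group G] (φ : 𝕋 → H) (g : G) (k : G →₀ ℤ) :
    specWeight (fun x => φ (shift g x)) k =
      specWeight φ (k.equivMapDomain (Equiv.mulLeft g)) := by
  unfold specWeight
  refine tsum_congr fun h => ?_
  congr 2
  let e : 𝕋 ≃ᵐ 𝕋 :=
    { toFun := shift g
      invFun := shift g⁻¹
      left_inv := shift_inv_shift g
      right_inv := shift_shift_inv g
      measurable_toFun := measurable_shift g
      measurable_invFun := measurable_shift g⁻¹ }
  have he := (measurePreserving_shift circleMeasure g).integral_comp e.measurableEmbedding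
    fun x => (fibreInd φ h x : ℂ) * chr (k.equivMapDomain (Equiv.mulLeft g)) x
  rw [← he]
  refine integral_congr_ae (Eventually.of_forall fun x => ?_)
  show _ = (fibreInd φ h (shift g x) : ℂ) * _
  rw [← chr_shift, shift_inv_shift]
  rfl

variable [MeasurableSpace H] [DiscreteMeasurableSpace H]

theorem measurable_fibreInd {W : Type} [MeasurableSpace W] {φ : W → H} (hφ : Measurable φ)
    (h : H) : Measurable (fibreInd φ h) :=
  measurable_one.indicator (hφ (.of_discrete))

theorem memLp_fibreInd {W : Type} [MeasurableSpace W] (μ : Measure W) [IsFiniteMeasure μ]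
    {φ : W → H} (hφ : Measurable φ) (h : H) : MemLp (fibreInd φ h) 2 μ :=
  (memLp_const (1 : ℝ)).indicator (hφ (.of_discrete))

theorem tsum_specWeight [Countable G] [Countable H] {φ : 𝕋 → H} (hφ : Measurable φ) :
    ∑' k, specWeight φ k = 1 := by
  unfold specWeight
  rw [ENNReal.tsum_comm]
  simp only [tsum_enorm_integral_chr _ (memLp_fibreInd _ hφ _)]
  rw [← lintegral_tsum fun h => ((measurable_fibreInd hφ h).enorm.pow_const 2).aemeasurable]
  simp [tsum_enorm_fibreInd]

theorem tsum_specDist_le [Countable G] [Countable H] {φ φ' : 𝕋 → H} (hφ : Measurable φ)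
    (hφ' : Measurable φ') :
    ∑' k, specDist φ φ' k ≤ 2 * bern G circleMeasure {x | φ x ≠ φ' x} := by
  unfold specDist
  rw [ENNReal.tsum_comm]
  simp only [tsum_enorm_integral_chr (fun x => fibreInd φ _ x - fibreInd φ' _ x)
    ((memLp_fibreInd _ hφ _).sub (memLp_fibreInd _ hφ' _))]
  have hm' : ∀ h, Measurable fun x => ‖fibreInd φ h x - fibreInd φ' h x‖ₑ ^ 2 := fun h =>
    ((measurable_fibreInd hφ h).sub (measurable_fibreInd hφ' h)).enorm.pow_const 2
  rw [← lintegral_tsum fun h => (hm' h).aemeasurable]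
  refine (lintegral_mono fun x => tsum_enorm_fibreInd_sub_le φ φ' x).trans ?_
  have hm : MeasurableSet {x | φ x ≠ φ' x} := (measurableSet_eq_fun hφ hφ').compl
  rw [show (2 : 𝕋 → ℝ≥0∞) = fun _ => 2 from rfl, lintegral_indicator_const hm]

theorem specWeight_le [Countable G] {φ φ' : 𝕋 → H} (hφ : Measurable φ) (hφ' : Measurable φ') (k : G →₀ ℤ)
    {η : ℝ} (hη : 0 < η) :
    specWeight φ k ≤ ENNReal.ofReal (1 + η) * specWeight φ' k +
      ENNReal.ofReal (1 + η⁻¹) * specDist φ φ' k := by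
  unfold specWeight specDist
  rw [← ENNReal.tsum_mul_left, ← ENNReal.tsum_mul_left, ← ENNReal.tsum_add]
  refine ENNReal.tsum_le_tsum fun h => (enorm_sq_le _
    (∫ x, (fibreInd φ' h x : ℂ) * chr k x ∂(bern G circleMeasure)) hη).trans_eq ?_
  have hfint : ∀ {ψ : 𝕋 → H}, Measurable ψ →
      Integrable (fun x => (fibreInd ψ h x : ℂ) * chr k x) (bern G circleMeasure) := by
    intro ψ hψ
    have h1 : Integrable (fun x => (fibreInd ψ h x : ℂ)) (bern G circleMeasure) :=
      ((memLp_fibreInd _ hψ h).integrable (by norm_num)).ofReal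
    exact h1.mul_bdd (c := 1) (chr k).continuous.aestronglyMeasurable
      (Eventually.of_forall fun x => (norm_chr k x).le)
  rw [← integral_sub (hfint hφ) (hfint hφ')]
  simp only [Complex.ofReal_sub, sub_mul]

theorem specWeight_zero [Countable H] {φ : 𝕋 → H} (hφ : Measurable φ) :
    specWeight φ 0 =
      ∫⁻ x, bern G circleMeasure {y | φ x = φ y} ∂(bern G circleMeasure) := by
  unfold specWeight
  have h1 : ∀ h, ‖∫ x, (fibreInd φ h x : ℂ) * chr (0 : G →₀ ℤ) x ∂(bern G circleMeasure)‖ₑ =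
      bern G circleMeasure (φ ⁻¹' {h}) := by
    intro h
    simp only [chr_zero, ContinuousMap.one_apply, mul_one]
    rw [integral_complex_ofReal, fibreInd, integral_indicator_one (hφ .of_discrete),
      enorm_eq_nnnorm, Complex.nnnorm_real, ← enorm_eq_nnnorm, measureReal_def,
      Real.enorm_eq_ofReal (by positivity), ENNReal.ofReal_toReal (by finiteness)]
  simp only [h1]
  have h2 : ∀ x, bern G circleMeasure {y | φ x = φ y} =
      ∑' h, (φ ⁻¹' {h}).indicator (fun _ => bern G circleMeasure (φ ⁻¹' {h})) x := by
    intro x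
    rw [tsum_eq_single (φ x) fun h hh => by simp [hh.symm]]
    simp only [Set.mem_preimage, Set.mem_singleton_iff, Set.indicator_of_mem]
    congr 1
    ext y
    simp [eq_comm]
  simp only [h2]
  rw [lintegral_tsum fun h => (measurable_const.indicator (hφ .of_discrete)).aemeasurable]
  refine tsum_congr fun h => ?_
  rw [lintegral_indicator_const (hφ .of_discrete), sq]

theorem measurable_specCoeff [Countable G] {X : Type} [MeasurableSpace X]
    {f : X × 𝕋 → ℝ} (hf : Measurable f) (k : G →₀ ℤ) :
    Measurable fun x => ‖∫ w, (f (x, w) : ℂ) * chr k w ∂(bern G circleMeasure)‖ₑ ^ 2 := by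
  have h1 : StronglyMeasurable fun p : X × 𝕋 => (f p : ℂ) * chr k p.2 :=
    ((Complex.measurable_ofReal.comp hf).mul
      ((chr k).continuous.measurable.comp measurable_snd)).stronglyMeasurable
  exact (h1.integral_prod_right' (ν := bern G circleMeasure)).measurable.enorm.pow_const 2

theorem measurable_specWeight [Countable G] [Countable H] {X : Type} [MeasurableSpace X]
    {f : X × 𝕋 → H} (hf : Measurable f) (k : G →₀ ℤ) :
    Measurable fun x => specWeight (fun w => f (x, w)) k :=
  Measurable.tsum fun h => measurable_specCoeff (measurable_fibreInd hf h) k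

theorem measurable_specDist [Countable G] [Countable H] {X : Type} [MeasurableSpace X]
    {f f' : X × 𝕋 → H} (hf : Measurable f) (hf' : Measurable f') (k : G →₀ ℤ) :
    Measurable fun x => specDist (fun w => f (x, w)) (fun w => f' (x, w)) k :=
  Measurable.tsum fun h =>
    measurable_specCoeff ((measurable_fibreInd hf h).sub (measurable_fibreInd hf' h)) k

open Classical in
/-- The proportion of the support of `k` which `π` maps into `T`. -/
noncomputable def supportRatio {L : Type} (π : G → L) (T : Set L) (k : G →₀ ℤ) : ℝ≥0∞ :=
  ((k.support.filter fun γ => π γ ∈ T).card : ℝ≥0∞) / k.support.card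

theorem supportRatio_le_one {L : Type} (π : G → L) (T : Set L) (k : G →₀ ℤ) :
    supportRatio π T k ≤ 1 :=
  ENNReal.div_le_of_le_mul (by
    classical
    rw [one_mul]
    exact Nat.cast_le.2 (Finset.card_le_card (Finset.filter_subset _ _)))

theorem supportRatio_univ {L : Type} (π : G → L) {k : G →₀ ℤ} (hk : k ≠ 0) :
    supportRatio π Set.univ k = 1 := by
  unfold supportRatio
  simp only [Set.mem_univ, Finset.filter_true]
  refine ENNReal.div_self ?_ (by finiteness)
  simpa using hk

theorem supportRatio_union {L : Type} (π : G → L) {S T : Set L} (hST : Disjoint S T)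
    (k : G →₀ ℤ) :
    supportRatio π (S ∪ T) k = supportRatio π S k + supportRatio π T k := by
  classical
  unfold supportRatio
  rw [← ENNReal.add_div]
  congr 1
  have hd : Disjoint (k.support.filter fun γ => π γ ∈ S) (k.support.filter fun γ => π γ ∈ T) :=
    Finset.disjoint_filter.2 fun γ _ h1 h2 => Set.disjoint_left.1 hST h1 h2
  rw [← Nat.cast_add, ← Finset.card_union_of_disjoint hd, ← Finset.filter_or]
  congr 2
  ext γ
  simp

theorem supportRatio_translate [Group G] {Λ : Subgroup G} (π : G → Λ)
    (hπ : ∀ (l : Λ) (g : G), π (l * g) = l * π g) (l : Λ) (T : Set Λ) (k : G →₀ ℤ) :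
    supportRatio π ((l * ·) '' T) (k.equivMapDomain (Equiv.mulLeft (l : G))) =
      supportRatio π T k := by
  classical
  unfold supportRatio
  rw [show (k.equivMapDomain (Equiv.mulLeft (l : G))).support =
    k.support.map (Equiv.mulLeft (l : G)).toEmbedding from rfl, Finset.filter_map,
    Finset.card_map, Finset.card_map]
  congr 3
  refine Finset.filter_congr fun γ _ => ?_
  simp [hπ]

theorem exists_equivariant_retraction [Group G] (Λ : Subgroup G) :
    ∃ π : G → Λ, ∀ (l : Λ) (g : G), π (l * g) = l * π g := by
  let r : G → G := fun g => (Quotient.mk (QuotientGroup.rightRel Λ) g).out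
  have hr : ∀ g, g * (r g)⁻¹ ∈ Λ := fun g =>
    QuotientGroup.rightRel_apply.1 (Quotient.mk_out (s := QuotientGroup.rightRel Λ) g)
  refine ⟨fun g => ⟨g * (r g)⁻¹, hr g⟩, fun l g => ?_⟩
  have h : r (l * g) = r g := by
    refine congrArg Quotient.out (Quotient.sound (s := QuotientGroup.rightRel Λ) ?_)
    refine QuotientGroup.rightRel_apply.2 ?_
    simp
  ext
  simp [h, mul_assoc]

/-- Spectral gap for the Bernoulli action of a nonamenable subgroup, relative to an arbitrary
measure preserving action and twisted by arbitrary functions: an almost equivariant map with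
countably many values almost does not depend on the Bernoulli coordinate. -/
theorem spectral_gap_circle [Group G] [Countable G] (Λ : Subgroup G) (hΛ : ¬ IsAmenable Λ) {ε : ℝ}
    (hε : 0 < ε) :
    ∃ (F : Finset Λ) (κ : ℝ), 0 < κ ∧
      ∀ (X : Type) [MeasurableSpace X] (μ : Measure X) [IsProbabilityMeasure μ] (τ : Λ → X → X)
        (H : Type) [Group H] [MeasurableSpace H] [DiscreteMeasurableSpace H] [Countable H]
        (f : X × 𝕋 → H) (a b : Λ → X → H), (∀ l ∈ F, MeasurePreserving (τ l) μ μ) →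
        Measurable f → (∀ l, Measurable (a l)) → (∀ l, Measurable (b l)) →
        (∀ l ∈ F, μ.prod (bern G circleMeasure)
          {p | f (τ l p.1, shift (l : G) p.2) ≠ a l p.1 * f p * (b l p.1)⁻¹} ≤ ENNReal.ofReal κ) →
        μ.prod ((bern G circleMeasure).prod (bern G circleMeasure))
          {q | f (q.1, q.2.1) ≠ f (q.1, q.2.2)} ≤ ENNReal.ofReal ε := by
  obtain ⟨π, hπ⟩ := exists_equivariant_retraction Λ
  obtain ⟨F, κ, hκ, hF⟩ := exists_finset_almost_invariant_le hΛ hε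
  set η : ℝ := κ / 2 with hη
  have hη0 : 0 < η := by positivity
  refine ⟨F, κ / (4 * (1 + η⁻¹)), by positivity, ?_⟩
  intro X _ μ _ τ H _ _ _ _ f a b hτ hf ha hb hP
  set ω := bern G circleMeasure with hω
  let q : (G →₀ ℤ) → ℝ≥0∞ := fun k => ∫⁻ x, specWeight (fun w => f (x, w)) k ∂μ
  have hfx : ∀ x, Measurable fun w => f (x, w) := fun x => hf.comp measurable_prodMk_left
  have hq1 : ∑' k, q k = 1 := by
    rw [← lintegral_tsum fun k => (measurable_specWeight hf k).aemeasurable]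
    simp [tsum_specWeight (hfx _)]
  have hq0 : q 0 = μ.prod (ω.prod ω) {p | f (p.1, p.2.1) = f (p.1, p.2.2)} := by
    have hm : MeasurableSet {p : X × 𝕋 × 𝕋 | f (p.1, p.2.1) = f (p.1, p.2.2)} :=
      measurableSet_eq_fun (by fun_prop) (by fun_prop)
    rw [Measure.prod_apply hm]
    refine lintegral_congr fun x => ?_
    rw [specWeight_zero (hfx x), Measure.prod_apply (measurable_prodMk_left hm)]
    rfl
  let d : Λ → (G →₀ ℤ) → ℝ≥0∞ := fun l k =>
    ∫⁻ x, specDist (fun w => f (τ l x, shift (l : G) w))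
      (fun w => a l x * f (x, w) * (b l x)⁻¹) k ∂μ
  have hm1 : ∀ l ∈ F, Measurable fun p : X × 𝕋 => f (τ l p.1, shift (l : G) p.2) := fun l hl =>
    hf.comp (((hτ l hl).measurable.comp measurable_fst).prodMk
      ((measurable_shift _).comp measurable_snd))
  have hm2 : ∀ l, Measurable fun p : X × 𝕋 => a l p.1 * f p * (b l p.1)⁻¹ := fun l =>
    (measurable_of_countable fun p : H × H × H => p.1 * p.2.1 * p.2.2⁻¹).comp
      (((ha l).comp measurable_fst).prodMk (hf.prodMk ((hb l).comp measurable_fst)))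
  have hd : ∀ l ∈ F, ∑' k, d l k ≤ 2 * ENNReal.ofReal (κ / (4 * (1 + η⁻¹))) := by
    intro l hl
    rw [← lintegral_tsum fun k => (measurable_specDist (hm1 l hl) (hm2 l) k).aemeasurable]
    refine le_trans ?_ (mul_le_mul_right (hP l hl) 2)
    have hms : MeasurableSet
        {p : X × 𝕋 | f (τ l p.1, shift (l : G) p.2) ≠ a l p.1 * f p * (b l p.1)⁻¹} :=
      (measurableSet_eq_fun (hm1 l hl) (hm2 l)).compl
    rw [Measure.prod_apply hms, ← lintegral_const_mul _ (measurable_measure_prodMk_left hms)]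
    refine lintegral_mono fun x => ?_
    exact tsum_specDist_le ((hm1 l hl).comp measurable_prodMk_left)
      ((hm2 l).comp measurable_prodMk_left)
  have hqd : ∀ l ∈ F, ∀ k, q (k.equivMapDomain (Equiv.mulLeft (l : G))) ≤
      ENNReal.ofReal (1 + η) * q k + ENNReal.ofReal (1 + η⁻¹) * d l k := by
    intro l hl k
    have h1 : q (k.equivMapDomain (Equiv.mulLeft (l : G))) =
        ∫⁻ x, specWeight (fun w => f (τ l x, shift (l : G) w)) k ∂μ := by
      simp only [q]
      rw [← (hτ l hl).lintegral_comp (measurable_specWeight hf _)]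
      refine lintegral_congr fun x => ?_
      exact (specWeight_shift (fun w => f (τ l x, w)) (l : G) k).symm
    rw [h1, ← lintegral_const_mul _ (measurable_specWeight hf k),
      ← lintegral_const_mul _ (measurable_specDist (hm1 l hl) (hm2 l) k),
      ← lintegral_add_left ((measurable_specWeight hf k).const_mul _)]
    refine lintegral_mono fun x => ?_
    rw [← specWeight_conj (fun w => f (x, w)) (a l x) (b l x)]
    exact specWeight_le ((hm1 l hl).comp measurable_prodMk_left)
      ((hm2 l).comp measurable_prodMk_left) k hη0
  let M : Set Λ → ℝ≥0∞ := fun T => ∑' k, q k * supportRatio π T k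
  have hM1 : ∀ T, M T ≤ 1 := fun T => by
    rw [← hq1]
    exact ENNReal.tsum_le_tsum fun k => mul_le_of_le_one_right' (supportRatio_le_one π T k)
  have hMt : ∀ T, M T ≠ ∞ := fun T => ((hM1 T).trans_lt ENNReal.one_lt_top).ne
  have hinv : ∀ l ∈ F, ∀ T, M ((l * ·) '' T) ≤ M T + ENNReal.ofReal κ := by
    intro l hl T
    calc M ((l * ·) '' T)
        = ∑' k : G →₀ ℤ, q (k.equivMapDomain (Equiv.mulLeft (l : G))) * supportRatio π T k := by
          simp only [M]
          rw [← (Finsupp.domCongr (M := ℤ) (Equiv.mulLeft (l : G))).toEquiv.tsum_eq]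
          refine tsum_congr fun k => ?_
          rw [← supportRatio_translate π hπ l T k]
          rfl
      _ ≤ ∑' k : G →₀ ℤ, (ENNReal.ofReal (1 + η) * (q k * supportRatio π T k) +
            ENNReal.ofReal (1 + η⁻¹) * d l k) := by
          refine ENNReal.tsum_le_tsum fun k => ?_
          refine (mul_le_mul_left (hqd l hl k) _).trans ?_
          rw [add_mul, mul_assoc]
          exact add_le_add le_rfl (mul_le_of_le_one_right' (supportRatio_le_one π T k))
      _ ≤ ENNReal.ofReal (1 + η) * M T +
            ENNReal.ofReal (1 + η⁻¹) * (2 * ENNReal.ofReal (κ / (4 * (1 + η⁻¹)))) := by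
          rw [ENNReal.tsum_add, ENNReal.tsum_mul_left, ENNReal.tsum_mul_left]
          gcongr
          exact hd l hl
      _ ≤ M T + ENNReal.ofReal κ := by
          rw [ENNReal.ofReal_add zero_le_one hη0.le, ENNReal.ofReal_one, add_mul, one_mul, add_assoc]
          gcongr
          calc _ ≤ ENNReal.ofReal η * 1 + ENNReal.ofReal (1 + η⁻¹) *
                (2 * ENNReal.ofReal (κ / (4 * (1 + η⁻¹)))) := by
                gcongr
                exact hM1 T
            _ = ENNReal.ofReal κ := by
                rw [show (2 : ℝ≥0∞) = ENNReal.ofReal 2 by simp,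
                  ← ENNReal.ofReal_mul (by positivity), ← ENNReal.ofReal_mul (by positivity),
                  mul_one, ← ENNReal.ofReal_add (by positivity) (by positivity)]
                congr 1
                have : (1 + η⁻¹) ≠ 0 := by positivity
                field_simp
                rw [hη]
                ring
  have hfin := hF (fun T => (M T).toReal) (fun T => ENNReal.toReal_nonneg)
    (fun T => by
      have := ENNReal.toReal_mono (by simp) (hM1 T)
      simpa using this)
    (fun S T hST => by
      show (M _).toReal = (M _).toReal + (M _).toReal
      rw [← ENNReal.toReal_add (hMt _) (hMt _)]
      congr 1
      simp only [M, supportRatio_union π hST, mul_add, ENNReal.tsum_add])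
    (fun l hl T => by
      have := ENNReal.toReal_mono (by finiteness [hMt T]) (hinv l hl T)
      rwa [ENNReal.toReal_add (hMt _) (by simp), ENNReal.toReal_ofReal hκ.le] at this)
  have hMu : μ.prod (ω.prod ω) {p | f (p.1, p.2.1) ≠ f (p.1, p.2.2)} ≤ M Set.univ := by
    have hm : MeasurableSet {p : X × 𝕋 × 𝕋 | f (p.1, p.2.1) = f (p.1, p.2.2)} :=
      measurableSet_eq_fun (by fun_prop) (by fun_prop)
    have h1 : 1 ≤ q 0 + M Set.univ := by
      classical
      rw [← hq1, ENNReal.tsum_eq_add_tsum_ite 0]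
      refine add_le_add le_rfl (ENNReal.tsum_le_tsum fun k => ?_)
      split_ifs with hk
      · simp
      · rw [supportRatio_univ π hk, mul_one]
    have h2 := prob_compl_eq_one_sub (μ := μ.prod (ω.prod ω)) hm
    rw [← hq0] at h2
    have h3 : {p : X × 𝕋 × 𝕋 | f (p.1, p.2.1) = f (p.1, p.2.2)}ᶜ =
        {p | f (p.1, p.2.1) ≠ f (p.1, p.2.2)} := rfl
    rw [← h3, h2]
    exact tsub_le_iff_left.2 h1
  rw [← ENNReal.ofReal_toReal (hMt Set.univ)] at hMu
  exact hMu.trans (ENNReal.ofReal_le_ofReal hfin)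

theorem spectral_gap [Group G] [Countable G] (Λ : Subgroup G) (hΛ : ¬ IsAmenable Λ)
    {B : Type} [MeasurableSpace B] [StandardBorelSpace B] (β : Measure B) [IsProbabilityMeasure β]
    {ε : ℝ} (hε : 0 < ε) :
    ∃ (F : Finset Λ) (κ : ℝ), 0 < κ ∧
      ∀ (X : Type) [MeasurableSpace X] (μ : Measure X) [IsProbabilityMeasure μ] (τ : Λ → X → X)
        (H : Type) [Group H] [MeasurableSpace H] [DiscreteMeasurableSpace H] [Countable H]
        (f : X × (G → B) → H) (a b : Λ → X → H), (∀ l ∈ F, MeasurePreserving (τ l) μ μ) →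
        Measurable f → (∀ l, Measurable (a l)) → (∀ l, Measurable (b l)) →
        (∀ l ∈ F, μ.prod (bern G β)
          {p | f (τ l p.1, shift (l : G) p.2) ≠ a l p.1 * f p * (b l p.1)⁻¹} ≤ ENNReal.ofReal κ) →
        μ.prod ((bern G β).prod (bern G β)) {q | f (q.1, q.2.1) ≠ f (q.1, q.2.2)} ≤
          ENNReal.ofReal ε := by
  obtain ⟨p, hp⟩ := exists_measurePreserving_circle β
  obtain ⟨F, κ, hκ, hF⟩ := spectral_gap_circle Λ hΛ hε
  refine ⟨F, κ, hκ, ?_⟩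
  intro X _ μ _ τ H _ _ _ _ f a b hτ hf ha hb hP
  have hP' := measurePreserving_bern_map (G := G) hp
  have h1 : MeasurePreserving (Prod.map id fun (x : 𝕋) g => p (x g))
      (μ.prod (bern G circleMeasure)) (μ.prod (bern G β)) :=
    (MeasurePreserving.id μ).prod hP'
  have h2 : MeasurePreserving (Prod.map id (Prod.map (fun (x : 𝕋) g => p (x g))
      fun (x : 𝕋) g => p (x g))) (μ.prod ((bern G circleMeasure).prod (bern G circleMeasure)))
      (μ.prod ((bern G β).prod (bern G β))) :=
    (MeasurePreserving.id μ).prod (hP'.prod hP')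
  have hms : MeasurableSet {q : X × (G → B) × (G → B) | f (q.1, q.2.1) ≠ f (q.1, q.2.2)} :=
    (measurableSet_eq_fun (by fun_prop) (by fun_prop)).compl
  rw [← h2.measure_preimage hms.nullMeasurableSet]
  refine hF X μ τ H (f ∘ Prod.map id fun (x : 𝕋) g => p (x g)) a b hτ (hf.comp h1.measurable)
    ha hb fun l hl => ?_
  refine le_trans (le_of_eq ?_) (hP l hl)
  have hm1 : Measurable fun p : X × (G → B) => f (τ l p.1, shift (l : G) p.2) :=
    hf.comp (((hτ l hl).measurable.comp measurable_fst).prodMk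
      ((measurable_shift _).comp measurable_snd))
  have hm2 : Measurable fun p : X × (G → B) => a l p.1 * f p * (b l p.1)⁻¹ :=
    (measurable_of_countable fun p : H × H × H => p.1 * p.2.1 * p.2.2⁻¹).comp
      (((ha l).comp measurable_fst).prodMk (hf.prodMk ((hb l).comp measurable_fst)))
  have hms : MeasurableSet {p : X × (G → B) |
      f (τ l p.1, shift (l : G) p.2) ≠ a l p.1 * f p * (b l p.1)⁻¹} :=
    (measurableSet_eq_fun hm1 hm2).compl
  rw [← h1.measure_preimage hms.nullMeasurableSet]
  rfl

end SpectralGap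

section Continuity

variable {Ω X κ : Type} [MeasurableSpace Ω] [m : MeasurableSpace X]

theorem tendsto_tsum_measureReal {J : Type} [Countable J] {P : Measure Ω} [IsProbabilityMeasure P]
    {l : Filter κ} (E : J → κ → Set Ω) (D : J → Set Ω) (hE : ∀ j k, MeasurableSet (E j k))
    (hD : ∀ j, MeasurableSet (D j)) (hd : Pairwise (Function.onFun Disjoint D))
    (hED : ∀ j k, E j k ⊆ D j) (hlim : ∀ j, Tendsto (fun k => P.real (E j k)) l (𝓝 0)) :
    Tendsto (fun k => P.real (⋃ j, E j k)) l (𝓝 0) := by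
  have h1 : ∀ k, P.real (⋃ j, E j k) = ∑' j, P.real (E j k) := fun k => by
    rw [measureReal_def, measure_iUnion
      (fun i j hij => (hd hij).mono (hED i k) (hED j k))
      (fun i => hE i k), ENNReal.tsum_toReal_eq fun i => by finiteness]
    rfl
  simp only [h1]
  rw [← tsum_zero (α := ℝ) (β := J)]
  refine tendsto_tsum_of_dominated_convergence (bound := fun i => P.real (D i)) ?_ hlim ?_
  · refine ENNReal.summable_toReal ?_
    rw [← measure_iUnion hd hD]
    finiteness
  · refine Eventually.of_forall fun k i => ?_
    rw [Real.norm_of_nonneg measureReal_nonneg]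
    exact measureReal_mono (hED i k)

theorem tendsto_measureReal_sdiff_of_piSystem {P : Measure Ω} [IsProbabilityMeasure P]
    {μ : Measure X} [IsProbabilityMeasure μ] {x : Ω → X} (hx : MeasurePreserving x P μ)
    {r : κ → Ω → X} (hr : ∀ k, MeasurePreserving (r k) P μ) {l : Filter κ} {C : Set (Set X)}
    (hgen : m = MeasurableSpace.generateFrom C) (hpi : IsPiSystem C)
    (hC : ∀ S ∈ C, Tendsto (fun k => P.real (x ⁻¹' S \ r k ⁻¹' S)) l (𝓝 0))
    (S : Set X) (hS : MeasurableSet S) :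
    Tendsto (fun k => P.real (x ⁻¹' S \ r k ⁻¹' S)) l (𝓝 0) := by
  induction S, hS using MeasurableSpace.induction_on_inter hgen hpi with
  | empty => simpa using tendsto_const_nhds
  | basic t ht => exact hC t ht
  | compl t ht ih =>
    refine ih.congr fun k => ?_
    have h1 := measureReal_inter_add_sdiff (μ := P) (s := x ⁻¹' t) ((hr k).measurable ht)
    have h2 := measureReal_inter_add_sdiff (μ := P) (s := r k ⁻¹' t) (hx.measurable ht)
    rw [(hx).measureReal_preimage ht.nullMeasurableSet] at h1
    rw [(hr k).measureReal_preimage ht.nullMeasurableSet, Set.inter_comm] at h2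
    have h3 : x ⁻¹' tᶜ \ r k ⁻¹' tᶜ = r k ⁻¹' t \ x ⁻¹' t := by
      ext ω
      simp [and_comm]
    rw [h3]
    linarith
  | iUnion f hd hm ih =>
    refine squeeze_zero (fun _ => measureReal_nonneg) (fun k => ?_)
      (tendsto_tsum_measureReal (P := P) (l := l) (fun i k => x ⁻¹' f i \ r k ⁻¹' f i)
      (fun i => x ⁻¹' f i) (fun i k => (hx.measurable (hm i)).diff ((hr k).measurable (hm i)))
      (fun i => hx.measurable (hm i)) (fun i j hij => (hd hij).preimage x)
      (fun i k => Set.sdiff_subset) ih)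
    refine measureReal_mono ?_
    rintro ω ⟨h1, h2⟩
    obtain ⟨i, hi⟩ := Set.mem_iUnion.1 (Set.mem_preimage.1 h1)
    exact Set.mem_iUnion.2 ⟨i, hi, fun h => h2 (Set.mem_iUnion.2 ⟨i, h⟩)⟩

theorem tendsto_measureReal_ne_of_piSystem {P : Measure Ω} [IsProbabilityMeasure P]
    {μ : Measure X} [IsProbabilityMeasure μ] {x : Ω → X} (hx : MeasurePreserving x P μ)
    {r : κ → Ω → X} (hr : ∀ k, MeasurePreserving (r k) P μ) {l : Filter κ} {C : Set (Set X)}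
    (hgen : m = MeasurableSpace.generateFrom C) (hpi : IsPiSystem C)
    (hC : ∀ S ∈ C, Tendsto (fun k => P.real (x ⁻¹' S \ r k ⁻¹' S)) l (𝓝 0))
    {H : Type} [Countable H] [MeasurableSpace H] [DiscreteMeasurableSpace H]
    {f : X → H} (hf : Measurable f) :
    Tendsto (fun k => P.real {ω | f (r k ω) ≠ f (x ω)}) l (𝓝 0) := by
  have hm : ∀ h : H, MeasurableSet (f ⁻¹' {h}) := fun h => hf (.of_discrete)
  refine squeeze_zero (fun _ => measureReal_nonneg) (fun k => ?_)
      (tendsto_tsum_measureReal (P := P) (l := l) (fun h k => x ⁻¹' (f ⁻¹' {h}) \ r k ⁻¹' (f ⁻¹' {h}))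
      (fun h => x ⁻¹' (f ⁻¹' {h}))
      (fun i k => (hx.measurable (hm i)).diff ((hr k).measurable (hm i)))
      (fun i => hx.measurable (hm i)) (fun i j hij => ?_)
      (fun i k => Set.sdiff_subset)
      (fun h => tendsto_measureReal_sdiff_of_piSystem hx hr hgen hpi hC _ (hm h)))
  · refine measureReal_mono ?_
    intro ω h
    exact Set.mem_iUnion.2 ⟨f (x ω), rfl, h⟩
  · exact ((Set.disjoint_singleton.2 hij).preimage f).preimage x

end Continuity

section Resample

variable {G : Type} {A : Type} [MeasurableSpace A]

open unitInterval

/-- Resampling a symbol: keep `a` unless `u < t`, in which case replace it by `b`. -/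
noncomputable def resSymbol (t : ℝ) (q : A × (A × I)) : A :=
  open Classical in if (q.2.2 : ℝ) < t then q.2.1 else q.1

/-- Coordinatewise resampling with rate `t`. -/
noncomputable def resample (t : ℝ) (p : (G → A) × (G → A × I)) : G → A :=
  fun g => resSymbol t (p.1 g, p.2 g)

theorem measurable_resSymbol (t : ℝ) : Measurable (resSymbol (A := A) t) := by
  classical
  refine Measurable.ite ?_ (by fun_prop) (by fun_prop)
  exact measurableSet_lt (by fun_prop) measurable_const

theorem measurable_resample (t : ℝ) : Measurable (resample (G := G) (A := A) t) :=
  measurable_pi_lambda _ fun g => (measurable_resSymbol t).comp (by fun_prop)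

theorem volume_real_lt {t : ℝ} (h0 : 0 ≤ t) (h1 : t ≤ 1) :
    (volume : Measure I).real {u : I | (u : ℝ) < t} = t := by
  have := unitInterval.volume_Iio ⟨t, h0, h1⟩
  change (volume (Set.Iio (⟨t, h0, h1⟩ : I))).toReal = t
  rw [this]
  simp [h0]

theorem volume_real_ge {t : ℝ} (h0 : 0 ≤ t) (h1 : t ≤ 1) :
    (volume : Measure I).real {u : I | t ≤ (u : ℝ)} = 1 - t := by
  have h2 : MeasurableSet {u : I | (u : ℝ) < t} :=
    measurableSet_lt (by fun_prop) measurable_const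
  have := probReal_compl_eq_one_sub (μ := (volume : Measure I)) h2
  rw [volume_real_lt h0 h1] at this
  rw [← this]
  congr 1
  ext u
  simp

variable (μ₀ : Measure A) [IsProbabilityMeasure μ₀]

/-- The law of a symbol and its resampling with probability `s`. -/
noncomputable def pairLaw (s : ℝ) : Measure (A × A) :=
  ENNReal.ofReal (1 - s) • μ₀.map (fun a => (a, a)) + ENNReal.ofReal s • μ₀.prod μ₀

theorem isProbabilityMeasure_pairLaw {s : ℝ} (h0 : 0 ≤ s) (h1 : s ≤ 1) :
    IsProbabilityMeasure (pairLaw μ₀ s) := by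
  constructor
  have : Measurable fun a : A => (a, a) := by fun_prop
  simp [pairLaw, Measure.map_apply this MeasurableSet.univ]
  rw [← ENNReal.ofReal_add (by linarith) h0]
  simp

theorem pairLaw_real_prod {s : ℝ} (h0 : 0 ≤ s) (h1 : s ≤ 1) {S T : Set A} (hS : MeasurableSet S)
    (hT : MeasurableSet T) : (pairLaw μ₀ s).real (S ×ˢ T) =
      (1 - s) * μ₀.real (S ∩ T) + s * (μ₀.real S * μ₀.real T) := by
  have : Measurable fun a : A => (a, a) := by fun_prop
  rw [pairLaw, measureReal_add_apply (by simp; finiteness) (by simp; finiteness),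
    measureReal_ennreal_smul_apply, measureReal_ennreal_smul_apply, ENNReal.toReal_ofReal h0,
      ENNReal.toReal_ofReal (by linarith),
    map_measureReal_apply this (hS.prod hT), measureReal_prod_prod]
  congr 2

theorem measurePreserving_pairLaw {Ω : Type} [MeasurableSpace Ω] (P : Measure Ω)
    [IsProbabilityMeasure P] {s : ℝ} (h0 : 0 ≤ s) (h1 : s ≤ 1) {q : Ω → A × A} (hq : Measurable q)
    (h : ∀ S T : Set A, MeasurableSet S → MeasurableSet T → P.real (q ⁻¹' (S ×ˢ T)) =
      (1 - s) * μ₀.real (S ∩ T) + s * (μ₀.real S * μ₀.real T)) :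
    MeasurePreserving q P (pairLaw μ₀ s) := by
  have := isProbabilityMeasure_pairLaw μ₀ h0 h1
  refine ⟨hq, ?_⟩
  have := Measure.isProbabilityMeasure_map (μ := P) hq.aemeasurable
  refine Measure.ext_prod fun {S T} hS hT => ?_
  rw [← measureReal_eq_measureReal_iff, pairLaw_real_prod μ₀ h0 h1 hS hT,
    map_measureReal_apply hq (hS.prod hT), h S T hS hT]

theorem measurePreserving_snd_pairLaw {s : ℝ} (h0 : 0 ≤ s) (h1 : s ≤ 1) :
    MeasurePreserving Prod.snd (pairLaw μ₀ s) μ₀ := by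
  have := isProbabilityMeasure_pairLaw μ₀ h0 h1
  have hm := Measure.isProbabilityMeasure_map (μ := pairLaw μ₀ s) measurable_snd.aemeasurable
  refine ⟨measurable_snd, Measure.ext fun S hS => ?_⟩
  rw [← measureReal_eq_measureReal_iff, map_measureReal_apply measurable_snd hS,
    ← Set.univ_prod, pairLaw_real_prod μ₀ h0 h1 .univ hS]
  simp
  ring

theorem measurePreserving_resSymbol_pair {α β : ℝ} (hα : 0 ≤ α) (hαβ : α ≤ β) (hβ : β ≤ 1) :
    MeasurePreserving (fun q => (resSymbol α q, resSymbol β q))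
      (μ₀.prod (μ₀.prod (volume : Measure I))) (pairLaw μ₀ (β - α)) := by
  refine measurePreserving_pairLaw μ₀ _ (by linarith) (by linarith)
    ((measurable_resSymbol α).prodMk (measurable_resSymbol β)) fun S T hS hT => ?_
  have hlt : ∀ t : ℝ, MeasurableSet {u : I | (u : ℝ) < t} := fun t =>
    measurableSet_lt (by fun_prop) measurable_const
  have hge : ∀ t : ℝ, MeasurableSet {u : I | t ≤ (u : ℝ)} := fun t =>
    measurableSet_le measurable_const (by fun_prop)
  have hno : ∀ (u : I) (s t : ℝ), s ≤ t → u ∈ {u : I | (u : ℝ) < s} → u ∉ {u : I | t ≤ (u : ℝ)} := by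
    intro u s t hst h h'
    simp only [Set.mem_ofPred_eq] at h h'
    linarith
  have hmid : (volume : Measure I).real ({u : I | α ≤ (u : ℝ)} ∩ {u : I | (u : ℝ) < β}) = β - α := by
    have h := measureReal_inter_add_sdiff (μ := (volume : Measure I))
      (s := {u : I | (u : ℝ) < β}) (hge α)
    have h2 : {u : I | (u : ℝ) < β} \ {u : I | α ≤ (u : ℝ)} = {u : I | (u : ℝ) < α} := by
      ext u
      simp only [Set.mem_sdiff, Set.mem_ofPred_eq, not_le]
      exact ⟨fun h => h.2, fun h => ⟨h.trans_le hαβ, h⟩⟩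
    rw [h2, volume_real_lt (hα.trans hαβ) hβ, volume_real_lt hα (hαβ.trans hβ)] at h
    rw [Set.inter_comm]
    linarith
  have heq : (fun q : A × (A × I) => (resSymbol α q, resSymbol β q)) ⁻¹' (S ×ˢ T) =
      (Set.univ ×ˢ ((S ∩ T) ×ˢ {u : I | (u : ℝ) < α}) ∪
        S ×ˢ (T ×ˢ ({u : I | α ≤ (u : ℝ)} ∩ {u : I | (u : ℝ) < β}))) ∪
        (S ∩ T) ×ˢ (Set.univ ×ˢ {u : I | β ≤ (u : ℝ)}) := by
    ext ⟨a, b, u⟩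
    rcases lt_or_ge (u : ℝ) α with h | h
    · simp [resSymbol, h, h.trans_le hαβ, h.not_ge, (h.trans_le hαβ).not_ge]
    · rcases lt_or_ge (u : ℝ) β with h' | h'
      · simp [resSymbol, h, h', h.not_gt, h'.not_ge]
      · simp [resSymbol, h, h', h.not_gt, h'.not_gt]
  rw [heq, measureReal_union, measureReal_union]
  · simp only [measureReal_prod_prod, hmid, volume_real_lt hα (hαβ.trans hβ),
      volume_real_ge (hα.trans hαβ) hβ, probReal_univ]
    ring
  · refine Set.disjoint_left.2 ?_
    rintro ⟨a, b, u⟩ h h'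
    exact hno _ _ _ le_rfl h.2.2 h'.2.2.1
  · exact hS.prod (hT.prod ((hge _).inter (hlt _)))
  · refine Set.disjoint_left.2 ?_
    rintro ⟨a, b, u⟩ h h'
    rcases h with h | h
    · exact hno _ _ _ hαβ h.2.2 h'.2.2
    · exact hno _ _ _ le_rfl h.2.2.2 h'.2.2
  · exact (hS.inter hT).prod (MeasurableSet.univ.prod (hge _))

theorem measurePreserving_resSymbol {t : ℝ} (h0 : 0 ≤ t) (h1 : t ≤ 1) :
    MeasurePreserving (resSymbol (A := A) t) (μ₀.prod (μ₀.prod (volume : Measure I))) μ₀ :=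
  (measurePreserving_snd_pairLaw μ₀ (by linarith) (by linarith)).comp
    (measurePreserving_resSymbol_pair μ₀ le_rfl h0 h1)

theorem measurePreserving_resSymbol_indep {t : ℝ} (h0 : 0 ≤ t) (h1 : t ≤ 1) :
    MeasurePreserving (fun q : A × ((A × I) × (A × I)) =>
        (resSymbol t (q.1, q.2.1), resSymbol t (q.1, q.2.2)))
      (μ₀.prod ((μ₀.prod (volume : Measure I)).prod (μ₀.prod (volume : Measure I))))
      (pairLaw μ₀ (1 - (1 - t) ^ 2)) := by
  refine measurePreserving_pairLaw μ₀ _ (by nlinarith) (by nlinarith)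
    (((measurable_resSymbol t).comp (by fun_prop)).prodMk
      ((measurable_resSymbol t).comp (by fun_prop))) fun S T hS hT => ?_
  set L : Set I := {u : I | (u : ℝ) < t}
  set K : Set I := {u : I | t ≤ (u : ℝ)}
  have hL : MeasurableSet L := measurableSet_lt (by fun_prop) measurable_const
  have hK : MeasurableSet K := measurableSet_le measurable_const (by fun_prop)
  have hLK : ∀ u ∈ L, u ∉ K := by
    intro u h h'
    simp only [L, K, Set.mem_ofPred_eq] at h h'
    linarith
  have heq : (fun q : A × ((A × I) × (A × I)) =>
        (resSymbol t (q.1, q.2.1), resSymbol t (q.1, q.2.2))) ⁻¹' (S ×ˢ T) =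
      ((Set.univ ×ˢ ((S ×ˢ L) ×ˢ (T ×ˢ L)) ∪ S ×ˢ ((Set.univ ×ˢ K) ×ˢ (T ×ˢ L))) ∪
        T ×ˢ ((S ×ˢ L) ×ˢ (Set.univ ×ˢ K))) ∪
        (S ∩ T) ×ˢ ((Set.univ ×ˢ K) ×ˢ (Set.univ ×ˢ K)) := by
    ext ⟨a, ⟨b, u⟩, b', u'⟩
    by_cases h : (u : ℝ) < t <;> by_cases h' : (u' : ℝ) < t <;>
    simp [resSymbol, L, K, h, h', ← not_lt, and_comm]
  rw [heq, measureReal_union, measureReal_union, measureReal_union]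
  · simp only [measureReal_prod_prod, volume_real_lt h0 h1, L, K,
      volume_real_ge h0 h1, probReal_univ]
    ring
  · refine Set.disjoint_left.2 ?_
    rintro ⟨a, ⟨b, u⟩, b', u'⟩ h h'
    exact hLK _ h.2.1.2 h'.2.1.2
  · exact hS.prod ((MeasurableSet.univ.prod hK).prod (hT.prod hL))
  · refine Set.disjoint_left.2 ?_
    rintro ⟨a, ⟨b, u⟩, b', u'⟩ h h'
    rcases h with h | h
    · exact hLK _ h.2.2.2 h'.2.2.2
    · exact hLK _ h.2.2.2 h'.2.2.2
  · exact hT.prod ((hS.prod hL).prod (MeasurableSet.univ.prod hK))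
  · refine Set.disjoint_left.2 ?_
    rintro ⟨a, ⟨b, u⟩, b', u'⟩ h h'
    rcases h with (h | h) | h
    · exact hLK _ h.2.1.2 h'.2.1.2
    · exact hLK _ h.2.2.2 h'.2.2.2
    · exact hLK _ h.2.1.2 h'.2.1.2
  · exact (hS.inter hT).prod ((MeasurableSet.univ.prod hK).prod (MeasurableSet.univ.prod hK))

end Resample

section UniformEstimate

open unitInterval

theorem measurePreserving_of_comp {X Y Z : Type} [MeasurableSpace X] [MeasurableSpace Y]
    [MeasurableSpace Z] {μ : Measure X} {ν : Measure Y} {ρ : Measure Z} {p : X → Y} {f : Y → Z}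
    (hp : MeasurePreserving p μ ν) (hf : Measurable f) (h : MeasurePreserving (f ∘ p) μ ρ) :
    MeasurePreserving f ν ρ :=
  ⟨hf, by rw [← hp.map_eq, Measure.map_map hf hp.measurable, h.map_eq]⟩

theorem measurePreserving_bern_map₂ {G B B' E : Type} [MeasurableSpace B] [MeasurableSpace B']
    [MeasurableSpace E] {β : Measure B} [IsProbabilityMeasure β] {β' : Measure B'}
    [IsProbabilityMeasure β'] {ρ : Measure E} [IsProbabilityMeasure ρ] {q : B × B' → E}
    (hq : MeasurePreserving q (β.prod β') ρ) :
    MeasurePreserving (fun (p : (G → B) × (G → B')) (g : G) => q (p.1 g, p.2 g))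
      ((bern G β).prod (bern G β')) (bern G ρ) :=
  measurePreserving_of_comp (measurePreserving_bern_prod β β')
    (measurable_pi_lambda _ fun g => hq.measurable.comp (by fun_prop))
    (measurePreserving_bern_map hq)

theorem measurePreserving_bern_map₃ {G B B' B'' E : Type} [MeasurableSpace B] [MeasurableSpace B']
    [MeasurableSpace B''] [MeasurableSpace E] {β : Measure B} [IsProbabilityMeasure β]
    {β' : Measure B'} [IsProbabilityMeasure β'] {β'' : Measure B''} [IsProbabilityMeasure β'']
    {ρ : Measure E} [IsProbabilityMeasure ρ] {q : B × B' × B'' → E}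
    (hq : MeasurePreserving q (β.prod (β'.prod β'')) ρ) :
    MeasurePreserving (fun (p : (G → B) × (G → B') × (G → B'')) (g : G) =>
        q (p.1 g, p.2.1 g, p.2.2 g))
      ((bern G β).prod ((bern G β').prod (bern G β''))) (bern G ρ) :=
  measurePreserving_of_comp
    ((MeasurePreserving.id (bern G β)).prod (measurePreserving_bern_prod β' β''))
    (measurable_pi_lambda _ fun g => hq.measurable.comp (by fun_prop))
    (measurePreserving_bern_map₂ (β' := β'.prod β'') hq)

variable {G : Type} {A : Type} [MeasurableSpace A] (μ₀ : Measure A) [IsProbabilityMeasure μ₀]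

theorem measurePreserving_resample {t : ℝ} (h0 : 0 ≤ t) (h1 : t ≤ 1) :
    MeasurePreserving (resample (G := G) t)
      ((bern G μ₀).prod (bern G (μ₀.prod (volume : Measure I)))) (bern G μ₀) :=
  measurePreserving_bern_map₂ (measurePreserving_resSymbol μ₀ h0 h1)

theorem tendsto_resample_ne {H : Type} [Countable H] [MeasurableSpace H]
    [DiscreteMeasurableSpace H] {f : (G → A) → H} (hf : Measurable f) {t : ℕ → ℝ}
    (h0 : ∀ n, 0 ≤ t n) (h1 : ∀ n, t n ≤ 1) (ht : Tendsto t atTop (𝓝 0)) :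
    Tendsto (fun n => ((bern G μ₀).prod (bern G (μ₀.prod (volume : Measure I)))).real
      {p | f (resample (t n) p) ≠ f p.1}) atTop (𝓝 0) := by
  refine tendsto_measureReal_ne_of_piSystem (x := Prod.fst) (r := fun n => resample (t n))
    measurePreserving_fst (fun n => measurePreserving_resample μ₀ (h0 n) (h1 n))
    (generateFrom_squareCylinders (ι := G) (α := fun _ => A)).symm
    (isPiSystem_squareCylinders (C := fun _ => {s | MeasurableSet s})
      (fun _ => MeasurableSpace.isPiSystem_measurableSet) (by simp)) ?_ hf
  rintro _ ⟨s, B, hB, rfl⟩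
  have hlim : Tendsto (fun n => (s.card : ℝ) * t n) atTop (𝓝 0) := by
    simpa using ht.const_mul (s.card : ℝ)
  refine squeeze_zero (fun _ => measureReal_nonneg) (fun n => ?_) hlim
  have hproj : ∀ i : G, MeasurePreserving
      (fun p : (G → A) × (G → A × I) => (p.2 i).2)
      ((bern G μ₀).prod (bern G (μ₀.prod (volume : Measure I)))) volume := fun i =>
    measurePreserving_snd.comp
      ((measurePreserving_eval_infinitePi (fun _ : G => μ₀.prod (volume : Measure I)) i).comp
        measurePreserving_snd)
  calc _ ≤ ((bern G μ₀).prod (bern G (μ₀.prod (volume : Measure I)))).real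
        (⋃ i ∈ s, (fun p : (G → A) × (G → A × I) => (p.2 i).2) ⁻¹' {u : I | (u : ℝ) < t n}) := by
        refine measureReal_mono ?_ (measure_ne_top _ _)
        rintro p ⟨hp1, hp2⟩
        by_contra hcon
        simp only [Set.mem_iUnion, not_exists, Set.mem_preimage, Set.mem_ofPred_eq, not_lt] at hcon
        refine hp2 fun i hi => ?_
        have : resample (t n) p i = p.1 i := by
          simp [resample, resSymbol, (hcon i hi).not_gt]
        rw [this]
        exact hp1 i hi
    _ ≤ ∑ i ∈ s, ((bern G μ₀).prod (bern G (μ₀.prod (volume : Measure I)))).real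
        ((fun p : (G → A) × (G → A × I) => (p.2 i).2) ⁻¹' {u : I | (u : ℝ) < t n}) :=
        measureReal_biUnion_finset_le _ _
    _ = ∑ i ∈ s, t n := Finset.sum_congr rfl fun i _ => by
        rw [(hproj i).measureReal_preimage, volume_real_lt (h0 n) (h1 n)]
        exact (measurableSet_lt (by fun_prop) measurable_const).nullMeasurableSet
    _ = (s.card : ℝ) * t n := by simp

variable {H : Type} [MeasurableSpace H] [DiscreteMeasurableSpace H] [Countable H]

theorem resample_pair_ne {f : (G → A) → H} (hf : Measurable f) {α β t : ℝ} (hα : 0 ≤ α)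
    (hαβ : α ≤ β) (hβ : β ≤ 1) (h0 : 0 ≤ t) (h1 : t ≤ 1) (h : β - α = 1 - (1 - t) ^ 2) :
    ((bern G μ₀).prod (bern G (μ₀.prod (volume : Measure I))))
        {p | f (resample α p) ≠ f (resample β p)} =
      ((bern G μ₀).prod ((bern G (μ₀.prod (volume : Measure I))).prod
        (bern G (μ₀.prod (volume : Measure I)))))
        {q | f (resample t (q.1, q.2.1)) ≠ f (resample t (q.1, q.2.2))} := by
  have := isProbabilityMeasure_pairLaw μ₀ (s := β - α) (by linarith) (by linarith)
  have hm1 := measurePreserving_bern_map₂ (G := G) (measurePreserving_resSymbol_pair μ₀ hα hαβ hβ)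
  have hi := measurePreserving_resSymbol_indep μ₀ h0 h1
  rw [← h] at hi
  have hm2 := measurePreserving_bern_map₃ (G := G) hi
  have hms : MeasurableSet {z : G → A × A | f (fun g => (z g).1) ≠ f (fun g => (z g).2)} :=
    (measurableSet_eq_fun (hf.comp (by fun_prop)) (hf.comp (by fun_prop))).compl
  exact (hm1.measure_preimage hms.nullMeasurableSet).trans
    (hm2.measure_preimage hms.nullMeasurableSet).symm

theorem exists_uniform_resample_le [Group G] [Countable G] [StandardBorelSpace A] [Group H]
    (G₀ : Subgroup G)
    (hcent : ¬ IsAmenable ↥(Subgroup.centralizer (G₀ : Set G))) {c : G → (G → A) → H}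
    (hcm : ∀ g, Measurable (c g))
    (hc : ∀ g g', ∀ᵐ x ∂bern G μ₀, c (g * g') x = c g (shift g' x) * c g' x) {ε : ℝ} (hε : 0 < ε) :
    ∃ N : ℕ, 0 < N ∧ ∀ g ∈ G₀, ∀ k < N,
      ((bern G μ₀).prod (bern G (μ₀.prod (volume : Measure I))))
        {p | c g (resample (k / N) p) ≠ c g (resample ((k + 1 : ℕ) / N) p)} ≤ ENNReal.ofReal ε := by
  obtain ⟨F, κ, hκ, hF⟩ := spectral_gap (Subgroup.centralizer (G₀ : Set G)) hcent
    (μ₀.prod (volume : Measure I)) hε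
  set P := (bern G μ₀).prod (bern G (μ₀.prod (volume : Measure I))) with hP
  set t : ℕ → ℝ := fun n => 1 - √(1 - 1 / ((n : ℝ) + 1)) with ht
  have hpos : ∀ n : ℕ, 0 ≤ 1 - 1 / ((n : ℝ) + 1) := fun n => by
    rw [sub_nonneg, div_le_one (by positivity)]
    linarith [n.cast_nonneg (α := ℝ)]
  have h0 : ∀ n, 0 ≤ t n := fun n => by
    rw [ht, sub_nonneg, Real.sqrt_le_left (by norm_num), one_pow]
    have : 0 ≤ 1 / ((n : ℝ) + 1) := by positivity
    linarith
  have h1 : ∀ n, t n ≤ 1 := fun n => by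
    simp only [ht]
    linarith [Real.sqrt_nonneg (1 - 1 / ((n : ℝ) + 1))]
  have htl : Tendsto t atTop (𝓝 0) := by
    have := (tendsto_one_div_add_atTop_nhds_zero_nat (𝕜 := ℝ)).const_sub 1
    have := (this.sqrt).const_sub 1
    simpa [ht] using this
  have hev : ∀ᶠ n in atTop, ∀ l ∈ F,
      P.real {p | c (l : G) (resample (t n) p) ≠ c (l : G) p.1} < κ / 2 := by
    rw [Finset.eventually_all]
    intro l _
    exact (tendsto_resample_ne μ₀ (hcm l) h0 h1 htl).eventually_lt_const (by positivity)
  obtain ⟨n, hn⟩ := hev.exists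
  refine ⟨n + 1, n.succ_pos, fun g hg k hk => ?_⟩
  have hk' : ((k + 1 : ℕ) : ℝ) ≤ ((n + 1 : ℕ) : ℝ) := by exact_mod_cast hk
  have hn0 : (0 : ℝ) < ((n + 1 : ℕ) : ℝ) := by positivity
  rw [resample_pair_ne μ₀ (hcm g) (t := t n) (by positivity) (by gcongr; simp)
    ((div_le_one hn0).2 hk') (h0 n) (h1 n)]
  swap
  · simp only [ht, sub_sub_cancel]
    rw [Real.sq_sqrt (hpos n)]
    push_cast
    ring
  refine hF (G → A) (bern G μ₀) (fun l => shift (l : G)) H (fun p => c g (resample (t n) p))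
    (fun l x => c l (shift g x)) (fun l x => c l x) (fun l _ => measurePreserving_shift μ₀ _)
    ((hcm g).comp (measurable_resample _)) (fun l => (hcm l).comp (measurable_shift g))
    (fun l => hcm l) fun l hl => ?_
  have hcomm : (l : G) * g = g * l := ((Subgroup.mem_centralizer_iff.1 l.2) g hg).symm
  have hres := measurePreserving_resample (G := G) μ₀ (h0 n) (h1 n)
  have hae : ∀ᵐ p ∂P, c g (shift (l : G) (resample (t n) p)) =
      c l (shift g (resample (t n) p)) * c g (resample (t n) p) *
        (c l (resample (t n) p))⁻¹ := by
    filter_upwards [hres.quasiMeasurePreserving.ae (hc g l),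
      hres.quasiMeasurePreserving.ae (hc l g)] with p hp1 hp2
    rw [eq_mul_inv_iff_mul_eq, ← hp1, ← hp2, hcomm]
  set E : Set ((G → A) × (G → A × I)) := {p | c (l : G) (resample (t n) p) ≠ c (l : G) p.1} with hE
  have hEm : MeasurableSet E :=
    (measurableSet_eq_fun ((hcm l).comp (measurable_resample _))
      ((hcm l).comp measurable_fst)).compl
  have hg : MeasurePreserving (Prod.map (shift g) (shift g)) P P :=
    (measurePreserving_shift μ₀ g).prod (measurePreserving_shift _ g)
  have hEP : P E ≤ ENNReal.ofReal (κ / 2) := by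
    rw [← ofReal_measureReal]
    exact ENNReal.ofReal_le_ofReal (hn l hl).le
  calc _ ≤ P (E ∪ Prod.map (shift g) (shift g) ⁻¹' E) := by
        refine measure_mono_ae ?_
        filter_upwards [hae] with p hp hne
        change p ∈ E ∪ Prod.map (shift g) (shift g) ⁻¹' E
        by_contra hcon
        simp only [hE, Set.mem_union, Set.mem_preimage, Set.mem_ofPred_eq, not_or, not_not] at hcon
        refine hne ?_
        change c g (shift (l : G) (resample (t n) p)) = _
        rw [hp, ← hcon.1]
        congr 2
        exact hcon.2
    _ ≤ P E + P E := by
        refine (measure_union_le _ _).trans ?_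
        rw [hg.measure_preimage hEm.nullMeasurableSet]
    _ ≤ ENNReal.ofReal (κ / 2) + ENNReal.ofReal (κ / 2) := add_le_add hEP hEP
    _ = ENNReal.ofReal κ := by
        rw [← ENNReal.ofReal_add (by positivity) (by positivity), add_halves]

end UniformEstimate

section Intertwiner

theorem exists_fixed_near {V K : Type*} [NormedAddCommGroup V] [InnerProductSpace ℝ V]
    [CompleteSpace V] [Nonempty K] (U : K → V →ₗᵢ[ℝ] V) (v₀ : V)
    (hU : ∀ g g', ∃ g'', U g (U g' v₀) = U g'' v₀) {r : ℝ} (hr : ∀ g, ‖U g v₀ - v₀‖ ≤ r) :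
    ∃ ξ, (∀ g, U g ξ = ξ) ∧ ‖ξ - v₀‖ ≤ r := by
  set S : Set V := Set.range fun g => U g v₀
  set C := closedConvexHull ℝ S
  have hCc : IsClosed C := isClosed_closedConvexHull
  have hCconv : Convex ℝ C := convex_closedConvexHull
  have hSC : S ⊆ C := subset_closedConvexHull
  obtain ⟨ξ, hξC, hξ⟩ := exists_norm_eq_iInf_of_complete_convex
    ((Set.range_nonempty _).mono hSC) hCc.isComplete hCconv 0
  have hmin : ∀ w ∈ C, ‖ξ‖ ≤ ‖w‖ := by
    intro w hw
    have h : ‖0 - ξ‖ ≤ ‖0 - w‖ := hξ ▸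
      ciInf_le (f := fun w : C => ‖0 - (w : V)‖) ⟨0, Set.forall_mem_range.2 fun _ => norm_nonneg _⟩
        ⟨w, hw⟩
    simpa using h
  refine ⟨ξ, fun g => ?_, ?_⟩
  · have hgC : U g ξ ∈ C := by
      have : C ⊆ U g ⁻¹' C := by
        refine closedConvexHull_min ?_ (hCconv.linear_preimage (U g).toLinearMap)
          (hCc.preimage (U g).continuous)
        rintro _ ⟨g', rfl⟩
        obtain ⟨g'', h⟩ := hU g g'
        exact hSC ⟨g'', h.symm⟩
      exact this hξC
    have hmid := hmin _ (hCconv hgC hξC (a := 1 / 2) (b := 1 / 2) (by norm_num) (by norm_num)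
      (by norm_num))
    rw [← smul_add, norm_smul, Real.norm_of_nonneg (by norm_num)] at hmid
    have hpar := parallelogram_law_with_norm ℝ (U g ξ) ξ
    rw [(U g).norm_map] at hpar
    have : ‖U g ξ - ξ‖ * ‖U g ξ - ξ‖ ≤ 0 := by nlinarith [norm_nonneg ξ]
    rw [← sub_eq_zero, ← norm_eq_zero]
    nlinarith [norm_nonneg (U g ξ - ξ)]
  · have : C ⊆ Metric.closedBall v₀ r := by
      refine closedConvexHull_min ?_ (convex_closedBall _ _) Metric.isClosed_closedBall
      rintro _ ⟨g, rfl⟩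
      simpa [dist_eq_norm] using hr g
    simpa [dist_eq_norm] using this hξC

variable {Y H K : Type} [MeasurableSpace Y] [MeasurableSpace H] [DiscreteMeasurableSpace H]
  [Countable H]

theorem enorm_Lp_two_sq {X : Type} [MeasurableSpace X] {μ : Measure X} (f : Lp ℝ 2 μ) :
    ‖f‖ₑ ^ 2 = ∫⁻ x, ‖f x‖ₑ ^ 2 ∂μ := by
  have := eLpNorm_nnreal_pow_eq_lintegral (f := f) (p := 2) (μ := μ) (by norm_num)
  rw [Lp.enorm_def]
  simpa using this

theorem measurePreserving_skew [Group H] (ν : Measure Y) [IsProbabilityMeasure ν] {τ : Y → Y}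
    (hτ : MeasurePreserving τ ν ν) {a b : Y → H} (ha : Measurable a) (hb : Measurable b) :
    MeasurePreserving (fun p : Y × H => (τ p.1, b p.1 * p.2 * (a p.1)⁻¹))
      (ν.prod count) (ν.prod count) := by
  refine hτ.skew_product (g := fun y h => b y * h * (a y)⁻¹) ?_ (ae_of_all _ fun y => ?_)
  · exact (measurable_of_countable fun p : H × H × H => p.1 * p.2.1 * p.2.2⁻¹).comp
      ((hb.comp measurable_fst).prodMk (measurable_snd.prodMk (ha.comp measurable_fst)))
  · refine Measure.ext fun S hS => ?_
    rw [Measure.map_apply .of_discrete hS]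
    have : (fun h => b y * h * (a y)⁻¹) ⁻¹' S =
        ((Equiv.mulLeft (b y)).trans (Equiv.mulRight (a y)⁻¹)).symm '' S := by
      rw [Equiv.image_symm_eq_preimage]
      rfl
    rw [this, count_injective_image (Equiv.injective _)]

theorem measurable_of_fibres {Y H : Type} [MeasurableSpace Y] [MeasurableSpace H] [Countable H]
    {f : Y → H} (h : ∀ k, MeasurableSet {y | f y = k}) : Measurable f :=
  measurable_to_countable' h

/-- An equivariant family of square summable functions with a dominating value yields an
equivariant map into `H`. -/
theorem exists_equivariant_of_lintegral {Y H K : Type} [MeasurableSpace Y] [MeasurableSpace H]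
    [Countable H] [Group H] (ν : Measure Y) [IsProbabilityMeasure ν]
    {τ : K → Y → Y} (herg : JointlyErgodic τ ν) {a b : K → Y → H} (F : Y → H → ℝ)
    (hF : ∀ h, Measurable fun y => F y h)
    (hinv : ∀ g, ∀ᵐ y ∂ν, ∀ h, F (τ g y) (b g y * h * (a g y)⁻¹) = F y h)
    (hclose : ∫⁻ y, ∑' h, ‖F y h - Set.indicator {(1 : H)} 1 h‖ₑ ^ 2 ∂ν < 1 / 2) :
    ∃ φ : Y → H, Measurable φ ∧ ∀ g, ∀ᵐ y ∂ν, φ (τ g y) = b g y * φ y * (a g y)⁻¹ := by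
  classical
  set N : Y → ℝ≥0∞ := fun y => ∑' h, ‖F y h‖ₑ ^ 2 with hN
  set D : H → Set Y := fun h => {y | N y ≠ ∞ ∧ N y < 2 * ‖F y h‖ₑ ^ 2} with hD
  have hNm : Measurable N := Measurable.tsum fun h => (hF h).enorm.pow_const 2
  have hDm : ∀ h, MeasurableSet (D h) := fun h =>
    (hNm (measurableSet_singleton ∞)).compl.inter
      (measurableSet_lt hNm (((hF h).enorm.pow_const 2).const_mul 2))
  have huniq : ∀ y h h', y ∈ D h → y ∈ D h' → h = h' := by
    intro y h h' hy hy'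
    by_contra hne
    have hle : ‖F y h‖ₑ ^ 2 + ‖F y h'‖ₑ ^ 2 ≤ N y := by
      rw [← Finset.sum_pair (f := fun h => ‖F y h‖ₑ ^ 2) hne]
      exact ENNReal.sum_le_tsum _
    have h2 := ENNReal.add_lt_add hy.2 hy'.2
    rw [← mul_add, ← two_mul] at h2
    exact absurd (mul_le_mul_right hle 2) (not_le.2 h2)
  have hstep : ∀ g, ∀ᵐ y ∂ν, ∀ h, (τ g y ∈ D (b g y * h * (a g y)⁻¹) ↔ y ∈ D h) := by
    intro g
    filter_upwards [hinv g] with y hy h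
    have hNe : N (τ g y) = N y := by
      simp only [hN]
      rw [← ((Equiv.mulLeft (b g y)).trans (Equiv.mulRight (a g y)⁻¹)).tsum_eq]
      refine tsum_congr fun h => ?_
      simp only [Equiv.trans_apply, Equiv.coe_mulLeft, Equiv.coe_mulRight]
      rw [hy]
    simp only [hD, Set.mem_ofPred_eq, hNe, hy]
  have hEinv : ∀ g, ∀ᵐ y ∂ν, (τ g y ∈ ⋃ h, D h ↔ y ∈ ⋃ h, D h) := by
    intro g
    filter_upwards [hstep g] with y hy
    simp only [Set.mem_iUnion]
    constructor
    · rintro ⟨h, hh⟩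
      refine ⟨(b g y)⁻¹ * h * a g y, (hy _).1 ?_⟩
      convert hh using 1
      group
    · rintro ⟨h, hh⟩
      exact ⟨_, (hy h).2 hh⟩
  have hEpos : ν (⋃ h, D h) ≠ 0 := by
    intro h0
    refine absurd hclose (not_lt.2 ?_)
    have h1 : ∀ᵐ y ∂ν, y ∉ ⋃ h, D h := measure_eq_zero_iff_ae_notMem.1 h0
    calc (1 / 2 : ℝ≥0∞) = ∫⁻ _, 1 / 2 ∂ν := by simp
      _ ≤ _ := lintegral_mono_ae (h1.mono fun y hy => ?_)
    have hsq : ∀ x : ℝ, ‖x‖ₑ ^ 2 = ENNReal.ofReal (x ^ 2) := fun x => by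
      rw [Real.enorm_eq_ofReal_abs, ← ENNReal.ofReal_pow (abs_nonneg x), sq_abs]
    set R := ∑' h : H, if h = 1 then 0 else ‖F y h‖ₑ ^ 2 with hR
    have hQ : ∑' h, ‖F y h - Set.indicator {(1 : H)} 1 h‖ₑ ^ 2 =
        ENNReal.ofReal ((F y 1 - 1) ^ 2) + R := by
      rw [ENNReal.tsum_eq_add_tsum_ite 1, ← hsq]
      congr 1
      · simp
      · refine tsum_congr fun h => ?_
        by_cases hh : h = 1 <;> simp [hh]
    have hNy : N y = ENNReal.ofReal (F y 1 ^ 2) + R := by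
      simp only [hN]
      rw [ENNReal.tsum_eq_add_tsum_ite 1, ← hsq]
    rw [hQ]
    by_cases hRt : R = ∞
    · simp [hRt]
    have hy1 : y ∉ D 1 := fun h => hy (Set.mem_iUnion.2 ⟨1, h⟩)
    have hle : 2 * ENNReal.ofReal (F y 1 ^ 2) ≤ ENNReal.ofReal (F y 1 ^ 2) + R := by
      rw [← hNy, ← hsq]
      by_contra hcon
      refine hy1 ⟨?_, not_le.1 hcon⟩
      rw [hNy]
      finiteness
    rw [two_mul, ENNReal.add_le_add_iff_left (by finiteness)] at hle
    refine le_trans ?_ (add_le_add_right hle _)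
    rw [← ENNReal.ofReal_add (by positivity) (by positivity)]
    calc (1 / 2 : ℝ≥0∞) = ENNReal.ofReal (1 / 2) := by
          rw [ENNReal.ofReal_div_of_pos (by norm_num)]
          simp
      _ ≤ _ := ENNReal.ofReal_le_ofReal (by nlinarith [sq_nonneg (F y 1 - 1 / 2)])
  have hE1 : ∀ᵐ y ∂ν, y ∈ ⋃ h, D h := by
    have := (herg _ (MeasurableSet.iUnion hDm) hEinv).resolve_left hEpos
    exact (mem_ae_iff_prob_eq_one (MeasurableSet.iUnion hDm)).2 this
  refine ⟨fun y => if h : ∃ h, y ∈ D h then h.choose else 1, ?_, ?_⟩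
  · refine measurable_of_fibres fun k => ?_
    have : {y | (if h : ∃ h, y ∈ D h then h.choose else 1) = k} =
        D k ∪ ((⋃ h, D h)ᶜ ∩ {_y | 1 = k}) := by
      ext y
      by_cases h : ∃ h, y ∈ D h
      · have h3 : y ∈ ⋃ h, D h := Set.mem_iUnion.2 h
        simp only [Set.mem_ofPred_eq, h, dif_pos, Set.mem_union, Set.mem_inter_iff,
          Set.mem_compl_iff, h3, not_true_eq_false, false_and, or_false]
        exact ⟨fun h' => h' ▸ h.choose_spec, fun h' => huniq y _ _ h.choose_spec h'⟩
      · have h3 : y ∉ ⋃ h, D h := fun h' => h (Set.mem_iUnion.1 h')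
        have h4 : y ∉ D k := fun h' => h ⟨k, h'⟩
        simp only [Set.mem_ofPred_eq, h, dite_false, Set.mem_union, h4, Set.mem_inter_iff,
          Set.mem_compl_iff, h3, not_false_eq_true, true_and, false_or]
    rw [this]
    exact (hDm k).union ((MeasurableSet.iUnion hDm).compl.inter (.const _))
  · intro g
    filter_upwards [hE1, hstep g] with y hy hs
    have h : ∃ h, y ∈ D h := Set.mem_iUnion.1 hy
    have h' : ∃ h, τ g y ∈ D h := ⟨_, (hs _).2 h.choose_spec⟩
    simp only [h, h', dif_pos]
    exact huniq _ _ _ h'.choose_spec ((hs _).2 h.choose_spec)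

/-- Two cocycles which are uniformly close over an ergodic action are cohomologous. -/
theorem exists_intertwiner [Group H] [Group K] (ν : Measure Y) [IsProbabilityMeasure ν]
    {τ : K → Y → Y} (hτ : ∀ g, MeasurePreserving (τ g) ν ν)
    (hmul : ∀ g g' y, τ (g * g') y = τ g (τ g' y)) (herg : JointlyErgodic τ ν)
    {a b : K → Y → H} (ha : ∀ g, Measurable (a g)) (hb : ∀ g, Measurable (b g))
    (hca : ∀ g g', ∀ᵐ y ∂ν, a (g * g') y = a g (τ g' y) * a g' y)
    (hcb : ∀ g g', ∀ᵐ y ∂ν, b (g * g') y = b g (τ g' y) * b g' y)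
    (hclose : ∀ g, ν {y | a g y ≠ b g y} ≤ ENNReal.ofReal (1 / 8)) :
    ∃ φ : Y → H, Measurable φ ∧ ∀ g, ∀ᵐ y ∂ν, φ (τ g y) = b g y * φ y * (a g y)⁻¹ := by
  set ρ : Measure (Y × H) := ν.prod count with hρ
  set θ : K → Y × H → Y × H := fun g p => (τ g p.1, b g p.1 * p.2 * (a g p.1)⁻¹) with hθ
  have hθm : ∀ g, MeasurePreserving (θ g) ρ ρ := fun g => measurePreserving_skew ν (hτ g) (ha g) (hb g)
  set S : Set (Y × H) := Set.univ ×ˢ {1} with hS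
  have hSm : MeasurableSet S := MeasurableSet.univ.prod (.of_discrete)
  have hSμ : ρ S = 1 := by simp [hS, hρ, Measure.prod_prod]
  have hSt : ρ S ≠ ∞ := by simp [hSμ]
  set U : K → Lp ℝ 2 ρ →ₗᵢ[ℝ] Lp ℝ 2 ρ := fun g => Lp.compMeasurePreservingₗᵢ ℝ (θ g) (hθm g)
  set ξ₀ : Lp ℝ 2 ρ := indicatorConstLp 2 hSm hSt 1 with hξ₀
  have hUU : ∀ g g', ∃ g'', U g (U g' ξ₀) = U g'' ξ₀ := by
    intro g g'
    have hm : ∀ g, MeasurableSet (θ g ⁻¹' S) := fun g => (hθm g).measurable hSm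
    have ht : ∀ g, ρ (θ g ⁻¹' S) ≠ ∞ := fun g => by
      rwa [(hθm g).measure_preimage hSm.nullMeasurableSet]
    have hm' : MeasurableSet (θ g ⁻¹' (θ g' ⁻¹' S)) := (hθm g).measurable (hm g')
    have ht' : ρ (θ g ⁻¹' (θ g' ⁻¹' S)) ≠ ∞ := by
      rw [(hθm g).measure_preimage (hm g').nullMeasurableSet]
      exact ht g'
    have e1 : U g (U g' ξ₀) = indicatorConstLp 2 hm' ht' 1 := rfl
    have e2 : U (g' * g) ξ₀ = indicatorConstLp 2 (hm (g' * g)) (ht (g' * g)) 1 := rfl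
    refine ⟨g' * g, ?_⟩
    rw [e1, e2]
    refine Lp.ext (indicatorConstLp_coeFn.trans (EventuallyEq.trans ?_ indicatorConstLp_coeFn.symm))
    have hfst : QuasiMeasurePreserving Prod.fst ρ ν := quasiMeasurePreserving_fst
    filter_upwards [hfst.ae (hca g' g), hfst.ae (hcb g' g)] with p hp1 hp2
    have : θ g' (θ g p) = θ (g' * g) p := by
      simp only [hθ, hp1, hp2, hmul]
      refine Prod.ext rfl ?_
      simp [mul_assoc]
    change S.indicator (fun _ => (1 : ℝ)) (θ g' (θ g p)) = S.indicator (fun _ => (1 : ℝ)) (θ (g' * g) p)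
    rw [this]
  have hnear : ∀ g, ‖U g ξ₀ - ξ₀‖ ≤ 1 / 2 := by
    intro g
    have hSg : MeasurableSet (θ g ⁻¹' S) := (hθm g).measurable hSm
    have hSgt : ρ (θ g ⁻¹' S) ≠ ∞ := by rwa [(hθm g).measure_preimage hSm.nullMeasurableSet]
    have h1 : U g ξ₀ = indicatorConstLp 2 hSg hSgt 1 := rfl
    rw [h1, hξ₀, ← dist_eq_norm, dist_indicatorConstLp_eq_norm, norm_indicatorConstLp (by norm_num) (by norm_num)]
    have hD : MeasurableSet {y | a g y ≠ b g y} := (measurableSet_eq_fun (ha g) (hb g)).compl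
    have hsub : S \ (θ g ⁻¹' S) = {y | a g y ≠ b g y} ×ˢ {(1 : H)} := by
      ext ⟨y, h⟩
      simp only [hS, hθ, Set.mem_sdiff, Set.mem_prod, Set.mem_univ, true_and, Set.mem_singleton_iff,
        Set.mem_preimage, Set.mem_ofPred_eq]
      constructor
      · rintro ⟨rfl, h2⟩
        refine ⟨fun h3 => h2 ?_, rfl⟩
        rw [h3]
        simp
      · rintro ⟨h1, rfl⟩
        refine ⟨rfl, fun h3 => h1 ?_⟩
        rw [mul_one, mul_inv_eq_one] at h3
        exact h3.symm
    have hm1 : ρ.real (S \ (θ g ⁻¹' S)) ≤ 1 / 8 := by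
      rw [hsub, measureReal_prod_prod, measureReal_def]
      have := ENNReal.toReal_le_of_le_ofReal (by norm_num) (hclose g)
      simpa [measureReal_def] using this
    have hm2 : ρ.real ((θ g ⁻¹' S) \ S) ≤ 1 / 8 := by
      have e1 := measureReal_inter_add_sdiff (μ := ρ) (s := S) hSg hSt
      have e2 := measureReal_inter_add_sdiff (μ := ρ) (s := θ g ⁻¹' S) hSm hSgt
      rw [(hθm g).measureReal_preimage hSm.nullMeasurableSet, Set.inter_comm] at e2
      linarith
    have hm : ρ.real ((θ g ⁻¹' S) ∆ S) ≤ 1 / 4 := by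
      rw [Set.symmDiff_def]
      exact (measureReal_union_le _ _).trans (by linarith)
    simp only [norm_one, one_mul, ENNReal.toReal_ofNat]
    rw [← Real.sqrt_eq_rpow]
    refine Real.sqrt_le_iff.2 ⟨by norm_num, hm.trans (by norm_num)⟩
  obtain ⟨ξ, hξU, hξ⟩ := exists_fixed_near U ξ₀ hUU hnear
  have hξm : Measurable (ξ : Y × H → ℝ) := (Lp.stronglyMeasurable ξ).measurable
  refine exists_equivariant_of_lintegral ν herg (a := a) (b := b) (fun y h => ξ (y, h))
    (fun h => hξm.comp (by fun_prop)) (fun g => ?_) ?_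
  · have h1 := Lp.coeFn_compMeasurePreserving ξ (hθm g)
    have h2 : Lp.compMeasurePreserving (θ g) (hθm g) ξ = ξ := hξU g
    rw [h2] at h1
    filter_upwards [Measure.ae_ae_of_ae_prod h1] with y hy h
    exact (ae_iff_of_countable.1 hy h (by simp)).symm
  · have h1 : ‖ξ - ξ₀‖ₑ ^ 2 ≤ ENNReal.ofReal (1 / 4) := by
      rw [← ofReal_norm, ← ENNReal.ofReal_pow (norm_nonneg _)]
      refine ENNReal.ofReal_le_ofReal ?_
      nlinarith [norm_nonneg (ξ - ξ₀)]
    rw [enorm_Lp_two_sq] at h1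
    have h2 : ∫⁻ p, ‖(ξ - ξ₀ : Lp ℝ 2 ρ) p‖ₑ ^ 2 ∂ρ =
        ∫⁻ p, ‖ξ p - Set.indicator {(1 : H)} 1 p.2‖ₑ ^ 2 ∂ρ := by
      refine lintegral_congr_ae ?_
      filter_upwards [Lp.coeFn_sub ξ ξ₀, indicatorConstLp_coeFn (p := 2) (hs := hSm) (hμs := hSt)
        (c := (1 : ℝ))] with p hp1 hp2
      rw [hp1, Pi.sub_apply, hξ₀, hp2]
      congr 3
      by_cases hp : p.2 = 1
      · rw [Set.indicator_of_mem (by simp [hS, hp]), Set.indicator_of_mem (by simp [hp])]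
        rfl
      · rw [Set.indicator_of_notMem (by simp [hS, hp]), Set.indicator_of_notMem (by simp [hp])]
    have h3 : Measurable fun p : Y × H => ‖ξ p - Set.indicator {(1 : H)} 1 p.2‖ₑ ^ 2 := by
      refine Measurable.pow_const ?_ 2
      refine (hξm.sub ?_).enorm
      exact (Measurable.of_discrete (f := Set.indicator {(1 : H)} (1 : H → ℝ))).comp measurable_snd
    have h4 := lintegral_prod (μ := ν) (ν := count) _ h3.aemeasurable
    rw [h2, show ∫⁻ p, ‖ξ p - Set.indicator {(1 : H)} 1 p.2‖ₑ ^ 2 ∂ρ = _ from h4] at h1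
    simp only [lintegral_count] at h1
    refine h1.trans_lt ?_
    rw [ENNReal.ofReal_div_of_pos (by norm_num)]
    simp only [ENNReal.ofReal_one, ENNReal.ofReal_ofNat, one_div]
    exact ENNReal.inv_lt_inv.2 (by norm_num)

end Intertwiner

section Untwisting

theorem measure_prod_setOf_eq_ne_zero {W H : Type} [MeasurableSpace W] [Countable H]
    (ν : Measure W) [IsProbabilityMeasure ν] (f : W → H) :
    (ν.prod ν) {p | f p.1 = f p.2} ≠ 0 := by
  intro h0
  have h1 : ∀ h : H, ν {w | f w = h} = 0 := fun h => by
    have h2 : (ν.prod ν) ({w | f w = h} ×ˢ {w | f w = h}) = 0 :=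
      measure_mono_null (fun p hp => hp.1.trans hp.2.symm) h0
    rw [Measure.prod_prod] at h2
    exact mul_self_eq_zero.1 h2
  have h2 : ν (⋃ h : H, {w | f w = h}) = 0 := measure_iUnion_null h1
  have h3 : (⋃ h : H, {w | f w = h}) = Set.univ := Set.eq_univ_of_forall fun w =>
    Set.mem_iUnion.2 ⟨f w, rfl⟩
  simp [h3] at h2

theorem measurePreserving_prod_prod_comm {X W : Type} [MeasurableSpace X] [MeasurableSpace W]
    (μ : Measure X) [SFinite μ] (ν : Measure W) [SFinite ν] :
    MeasurePreserving (fun p : (X × X) × (W × W) => ((p.1.1, p.2.1), (p.1.2, p.2.2)))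
      ((μ.prod μ).prod (ν.prod ν)) ((μ.prod ν).prod (μ.prod ν)) := by
  have h1 : MeasurePreserving (fun p : X × (W × W) => (p.2.1, (p.1, p.2.2)))
      (μ.prod (ν.prod ν)) (ν.prod (μ.prod ν)) :=
    ((measurePreserving_prodAssoc ν μ ν).comp
      ((measurePreserving_swap (μ := μ) (ν := ν)).prod (MeasurePreserving.id ν))).comp
      (measurePreserving_prodAssoc μ ν ν).symm
  exact ((measurePreserving_prodAssoc μ ν (μ.prod ν)).symm.comp
    ((MeasurePreserving.id μ).prod h1)).comp (measurePreserving_prodAssoc μ μ (ν.prod ν))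

variable {X W K H : Type} [MeasurableSpace X] [MeasurableSpace W] [MeasurableSpace H]
  [DiscreteMeasurableSpace H] [Countable H]

/-- A function on a doubly ergodic space which is equivariant up to constants is constant. -/
theorem exists_ae_eq_const_of_equivariant [Group H] (μ : Measure X) [IsProbabilityMeasure μ]
    {T : K → X → X} (herg : JointlyErgodic (fun k (p : X × X) => (T k p.1, T k p.2)) (μ.prod μ))
    {f : X → H} (hf : Measurable f) {α β : K → H}
    (h : ∀ k, ∀ᵐ x ∂μ, f (T k x) = α k * f x * β k) : ∃ y, ∀ᵐ x ∂μ, f x = y := by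
  have hS : MeasurableSet {p : X × X | f p.1 = f p.2} :=
    measurableSet_eq_fun (hf.comp measurable_fst) (hf.comp measurable_snd)
  have hone := (herg _ hS fun k => by
    filter_upwards [quasiMeasurePreserving_fst.ae (h k), quasiMeasurePreserving_snd.ae (h k)]
      with p hp1 hp2
    rw [hp1, hp2]
    simp).resolve_left (measure_prod_setOf_eq_ne_zero μ f)
  have hae : ∀ᵐ p ∂μ.prod μ, f p.1 = f p.2 := (prob_compl_eq_zero_iff hS).2 hone
  obtain ⟨x, hx⟩ := (Measure.ae_ae_of_ae_prod hae).exists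
  exact ⟨f x, hx.mono fun _ h => h.symm⟩

/-- If a cocycle over `X` becomes cohomologous, over a product `X × W`, to a cocycle which depends
on `W` only, then it is cohomologous to a homomorphism. -/
theorem exists_untwist [Group H] (μ : Measure X) [IsProbabilityMeasure μ] (ν : Measure W)
    [IsProbabilityMeasure ν] {T : K → X → X} {R : K → W → W}
    (hT : ∀ k, MeasurePreserving (T k) μ μ) (hR : ∀ k, MeasurePreserving (R k) ν ν)
    (herg : JointlyErgodic (fun k (p : (X × W) × (X × W)) =>
      ((T k p.1.1, R k p.1.2), (T k p.2.1, R k p.2.2))) ((μ.prod ν).prod (μ.prod ν)))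
    {c : K → X → H} {d : K → W → H} {Φ : X × W → H} (hΦ : Measurable Φ)
    (h : ∀ k, ∀ᵐ p ∂μ.prod ν, Φ (T k p.1, R k p.2) = d k p.2 * Φ p * (c k p.1)⁻¹) :
    ∃ ψ : X → H, Measurable ψ ∧ ∀ k, ∃ y, ∀ᵐ x ∂μ, ψ (T k x) * c k x * (ψ x)⁻¹ = y := by
  set S : Set ((X × W) × (X × W)) :=
    {p | (Φ (p.1.1, p.2.2))⁻¹ * Φ p.2 = (Φ p.1)⁻¹ * Φ (p.2.1, p.1.2)} with hS
  have hSm : MeasurableSet S := by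
    refine measurableSet_eq_fun ?_ ?_
    · exact (hΦ.comp (by fun_prop)).inv.mul (hΦ.comp (by fun_prop))
    · exact (hΦ.comp (by fun_prop)).inv.mul (hΦ.comp (by fun_prop))
  have hS0 : ((μ.prod ν).prod (μ.prod ν)) S ≠ 0 := by
    rw [← (measurePreserving_prod_prod_comm μ ν).measure_preimage hSm.nullMeasurableSet]
    intro h0
    have h1 := Measure.measure_ae_null_of_prod_null h0
    obtain ⟨⟨x, x'⟩, hx⟩ := h1.exists
    refine measure_prod_setOf_eq_ne_zero ν (fun w => (Φ (x, w))⁻¹ * Φ (x', w))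
      (measure_mono_null (fun p hp => ?_) hx)
    exact Eq.symm hp
  have hone := (herg S hSm fun k => by
    have q12 : QuasiMeasurePreserving (Prod.map Prod.fst Prod.snd)
        ((μ.prod ν).prod (μ.prod ν)) (μ.prod ν) :=
      (measurePreserving_fst.prod measurePreserving_snd).quasiMeasurePreserving
    have q21 : QuasiMeasurePreserving
        (Prod.swap ∘ Prod.map Prod.snd Prod.fst)
        ((μ.prod ν).prod (μ.prod ν)) (μ.prod ν) :=
      (measurePreserving_swap.comp
        (measurePreserving_snd.prod measurePreserving_fst)).quasiMeasurePreserving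
    filter_upwards [quasiMeasurePreserving_fst.ae (h k), quasiMeasurePreserving_snd.ae (h k),
      q12.ae (h k), q21.ae (h k)] with p hp1 hp2 hp3 hp4
    simp only [Prod.map, Function.comp, Prod.swap] at hp3 hp4
    simp only [hS, Set.mem_ofPred_eq, hp1, hp2, hp3, hp4]
    simp only [mul_inv_rev, mul_assoc, inv_mul_cancel_left, inv_inv, mul_right_inj]
    rw [← mul_assoc, ← mul_assoc _ _ (c k p.2.1)⁻¹, mul_left_inj]).resolve_left hS0
  have hae : ∀ᵐ p ∂(μ.prod ν).prod (μ.prod ν), p ∈ S := (prob_compl_eq_zero_iff hSm).2 hone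
  obtain ⟨⟨x₀, w₀⟩, hz⟩ := (Measure.ae_ae_of_ae_prod hae).exists
  have hψm : Measurable fun x => (Φ (x₀, w₀))⁻¹ * Φ (x, w₀) :=
    (hΦ.comp (by fun_prop)).const_mul _
  refine ⟨fun x => (Φ (x₀, w₀))⁻¹ * Φ (x, w₀), hψm, fun k => ?_⟩
  set ψ : X → H := fun x => (Φ (x₀, w₀))⁻¹ * Φ (x, w₀) with hψ
  set a : W → H := fun w => Φ (x₀, w)
  have hfac : ∀ᵐ p ∂μ.prod ν, Φ p = a p.2 * ψ p.1 := hz.mono fun p hp => by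
    simp only [hS, Set.mem_ofPred_eq] at hp
    simp only [a, hψ, ← hp, mul_inv_cancel_left]
  have hk : ∀ᵐ p ∂μ.prod ν,
      ψ (T k p.1) * c k p.1 * (ψ p.1)⁻¹ = (a (R k p.2))⁻¹ * d k p.2 * a p.2 := by
    filter_upwards [hfac, ((hT k).prod (hR k)).quasiMeasurePreserving.ae hfac, h k]
      with p hp1 hp2 hp3
    simp only [Prod.map] at hp2
    rw [hp2, hp1] at hp3
    rw [← eq_inv_mul_iff_mul_eq] at hp3
    rw [hp3]
    simp [mul_assoc]
  have hk' := Measure.ae_ae_of_ae_prod hk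
  obtain ⟨x₁, hx₁⟩ := hk'.exists
  refine ⟨ψ (T k x₁) * c k x₁ * (ψ x₁)⁻¹, hk'.mono fun x hx => ?_⟩
  obtain ⟨w, hw1, hw2⟩ := (hx.and hx₁).exists
  exact hw1.trans hw2.symm

end Untwisting

section Rigidity

open unitInterval

theorem resample_zero {G A : Type} (p : (G → A) × (G → A × I)) : resample 0 p = p.1 := by
  funext g
  simp only [resample, resSymbol]
  exact if_neg (not_lt.2 (p.2 g).2.2.1)

theorem resample_one_ae {G A : Type} [Countable G] [MeasurableSpace A] (μ₀ : Measure A)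
    [IsProbabilityMeasure μ₀] :
    ∀ᵐ p ∂(bern G μ₀).prod (bern G (μ₀.prod (volume : Measure I))),
      resample 1 p = fun g => (p.2 g).1 := by
  have h1 : ∀ᵐ u : I ∂(volume : Measure I), (u : ℝ) < 1 := by
    filter_upwards [compl_mem_ae_iff.2 (measure_singleton (μ := (volume : Measure I)) 1)] with u hu
    exact lt_of_le_of_ne u.2.2 fun h => hu (Subtype.ext h)
  have h2 : ∀ᵐ w ∂bern G (μ₀.prod (volume : Measure I)), ∀ g, ((w g).2 : ℝ) < 1 := by
    refine ae_all_iff.2 fun g => ?_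
    have h3 := measurePreserving_eval_infinitePi (fun _ : G => μ₀.prod (volume : Measure I)) g
    exact h3.quasiMeasurePreserving.ae (quasiMeasurePreserving_snd.ae h1)
  filter_upwards [quasiMeasurePreserving_snd.ae h2] with p hp
  funext g
  simp only [resample, resSymbol]
  exact if_pos (hp g)

variable {G A H : Type} [Group G] [MeasurableSpace A] (μ₀ : Measure A)
  [IsProbabilityMeasure μ₀] [MeasurableSpace H] [DiscreteMeasurableSpace H] [Countable H] [Group H]

theorem exists_ae_const_of_centralizer [Countable G] [StandardBorelSpace A] (G₀ : Subgroup G)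
    (hinf : (G₀ : Set G).Infinite)
    (hcent : ¬ IsAmenable ↥(Subgroup.centralizer (G₀ : Set G))) {c : G → (G → A) → H}
    (hcm : ∀ g, Measurable (c g))
    (hc : ∀ g g', ∀ᵐ x ∂bern G μ₀, c (g * g') x = c g (shift g' x) * c g' x) :
    ∃ ψ : (G → A) → H, Measurable ψ ∧
      ∀ g ∈ G₀, ∃ y, ∀ᵐ x ∂bern G μ₀, ψ (shift g x) * c g x * (ψ x)⁻¹ = y := by
  obtain ⟨N, hN, hclose⟩ := exists_uniform_resample_le μ₀ G₀ hcent hcm hc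
    (ε := 1 / 8) (by norm_num)
  set ν := bern G (μ₀.prod (volume : Measure I))
  set P := (bern G μ₀).prod ν with hP
  have hZ := (bernoulliFactor_shift (G := G) μ₀).prod
    (bernoulliFactor_shift (G := G) (μ₀.prod (volume : Measure I)))
  set τ : G₀ → (G → A) × (G → A × I) → (G → A) × (G → A × I) :=
    fun g p => (shift (g : G) p.1, shift (g : G) p.2) with hτ
  have hτm : ∀ g, MeasurePreserving (τ g) P P := fun g =>
    (measurePreserving_shift μ₀ _).prod (measurePreserving_shift _ _)
  have hN' : (0 : ℝ) < N := by exact_mod_cast hN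
  have hmid : ∀ k ≤ N, (0 : ℝ) ≤ k / N ∧ (k : ℝ) / N ≤ 1 := fun k hk =>
    ⟨by positivity, (div_le_one hN').2 (by exact_mod_cast hk)⟩
  have hcoc : ∀ k ≤ N, ∀ g g' : G₀, ∀ᵐ p ∂P, c (g * g' : G₀) (resample ((k : ℝ) / N) p) =
      c g (resample (k / N) (τ g' p)) * c g' (resample (k / N) p) := fun k hk g g' =>
    (measurePreserving_resample μ₀ (hmid k hk).1 (hmid k hk).2).quasiMeasurePreserving.ae
      (hc g g')
  have hchain : ∀ m ≤ N, ∃ Φ : (G → A) × (G → A × I) → H, Measurable Φ ∧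
      ∀ g : G₀, ∀ᵐ p ∂P, Φ (τ g p) = c g (resample ((m : ℝ) / N) p) * Φ p * (c g p.1)⁻¹ := by
    intro m
    induction m with
    | zero =>
      refine fun _ => ⟨fun _ => 1, measurable_const, fun g => Eventually.of_forall fun p => ?_⟩
      simp [resample_zero]
    | succ m ih =>
      intro hm
      obtain ⟨Φ, hΦm, hΦ⟩ := ih (by omega)
      obtain ⟨φ, hφm, hφ⟩ := exists_intertwiner P hτm
        (fun g g' p => Prod.ext (shift_mul _ _ _) (shift_mul _ _ _))
        (hZ.jointlyErgodic G₀ hinf)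
        (a := fun g p => c g (resample ((m : ℝ) / N) p))
        (b := fun g p => c g (resample (((m + 1 : ℕ) : ℝ) / N) p))
        (fun g => (hcm g).comp (measurable_resample _))
        (fun g => (hcm g).comp (measurable_resample _))
        (hcoc m (by omega)) (hcoc (m + 1) hm) fun g => hclose g g.2 m (by omega)
      refine ⟨fun p => φ p * Φ p, hφm.mul hΦm, fun g => ?_⟩
      filter_upwards [hΦ g, hφ g] with p hp1 hp2
      rw [hp1, hp2]
      simp [mul_assoc]
  obtain ⟨Φ, hΦm, hΦ⟩ := hchain N le_rfl
  rw [div_self hN'.ne'] at hΦ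
  obtain ⟨ψ, hψm, hψ⟩ := exists_untwist (K := G₀) (bern G μ₀) ν
    (T := fun g => shift (g : G)) (R := fun g => shift (g : G))
    (fun g => measurePreserving_shift μ₀ _) (fun g => measurePreserving_shift _ _)
    ((hZ.prod hZ).jointlyErgodic G₀ hinf) (c := fun g => c g)
    (d := fun g w => c g fun i => (w i).1) hΦm fun g => by
      filter_upwards [hΦ g, resample_one_ae (G := G) μ₀] with p hp1 hp2
      rw [← hp2]
      exact hp1
  exact ⟨ψ, hψm, fun g hg => hψ ⟨g, hg⟩⟩

/-- Untwisting extends along one step of a `wq`-normal chain. -/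
theorem exists_ae_const_of_wqNormal {c : G → (G → A) → H} (hcm : ∀ g, Measurable (c g))
    (hc : ∀ g g', ∀ᵐ x ∂bern G μ₀, c (g * g') x = c g (shift g' x) * c g' x) {K L : Subgroup G}
    (hK : ∀ g ∈ K, ∃ y, ∀ᵐ x ∂bern G μ₀, c g x = y)
    (hL : Subgroup.closure {g : G | g ∈ L ∧ {x : G | x ∈ K ∧ g⁻¹ * x * g ∈ K}.Infinite} = L) :
    ∀ g ∈ L, ∃ y, ∀ᵐ x ∂bern G μ₀, c g x = y := by
  intro g hg
  rw [← hL] at hg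
  induction hg using Subgroup.closure_induction with
  | mem g hg =>
    obtain ⟨-, hinf⟩ := hg
    set Q : Subgroup G := K ⊓ K.comap (MulAut.conj g).toMonoidHom with hQ
    have hQinf : (Q : Set G).Infinite := by
      refine (hinf.image (f := fun x => g⁻¹ * x * g) fun x _ y _ hxy => by simpa using hxy).mono ?_
      rintro _ ⟨x, ⟨hx1, hx2⟩, rfl⟩
      refine ⟨hx2, ?_⟩
      simpa [mul_assoc] using hx1
    choose α hα using fun k : Q => hK k k.2.1
    choose β hβ using fun k : Q => hK (g * k * g⁻¹) k.2.2
    have hX := bernoulliFactor_shift (G := G) μ₀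
    refine exists_ae_eq_const_of_equivariant (K := Q) (bern G μ₀)
      ((hX.prod hX).jointlyErgodic Q hQinf) (hcm g) (α := β) (β := fun k => (α k)⁻¹) fun k => ?_
    filter_upwards [hc g k, hc (g * k * g⁻¹) g, hα k,
      (measurePreserving_shift μ₀ g).quasiMeasurePreserving.ae (hβ k)] with x h1 h2 h3 h4
    rw [eq_mul_inv_iff_mul_eq, ← h3, ← h4, ← h1, ← h2]
    simp
  | one =>
    refine ⟨1, ?_⟩
    filter_upwards [hc 1 1] with x hx
    have h1 : shift (1 : G) x = x := by
      funext h
      simp [shift]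
    rw [mul_one, h1] at hx
    exact left_eq_mul.1 hx
  | mul g g' _ _ ih ih' =>
    obtain ⟨y, hy⟩ := ih
    obtain ⟨y', hy'⟩ := ih'
    refine ⟨y * y', ?_⟩
    filter_upwards [hc g g', (measurePreserving_shift μ₀ g').quasiMeasurePreserving.ae hy, hy']
      with x h1 h2 h3
    rw [h1, h2, h3]
  | inv g _ ih =>
    obtain ⟨y, hy⟩ := ih
    refine ⟨y⁻¹, ?_⟩
    filter_upwards [hc g g⁻¹, hc 1 1,
      (measurePreserving_shift μ₀ g⁻¹).quasiMeasurePreserving.ae hy] with x h1 h2 h3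
    have h4 : shift (1 : G) x = x := by
      funext h
      simp [shift]
    rw [mul_one, h4] at h2
    rw [mul_inv_cancel, h3, left_eq_mul.1 h2] at h1
    exact eq_inv_of_mul_eq_one_right h1.symm

end Rigidity

end CocycleSuperrigidity

/-- Popa. Cocycle superrigidity of Bernoulli actions of groups admitting a
wq-normal chain of infinite subgroups starting from a subgroup with nonamenable centralizer. -/
theorem stmt7
    (G : Type) [Group G] [Countable G]
    (n : ℕ) (Gs : ℕ → Subgroup G)
    (hchain : ∀ k : ℕ, k < n → Gs k ≤ Gs (k + 1))
    (htop : Gs n = ⊤)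
    (hinf : ∀ k : ℕ, k ≤ n → ((Gs k : Set G)).Infinite)
    (hwq : ∀ k : ℕ, k < n →
      Subgroup.closure {g : G | g ∈ Gs (k + 1) ∧
        {x : G | x ∈ Gs k ∧ g⁻¹ * x * g ∈ Gs k}.Infinite} = Gs (k + 1))
    (hcent : ¬ IsAmenable ↥(Subgroup.centralizer (Gs 0 : Set G)))
    (A : Type) [MeasurableSpace A] [StandardBorelSpace A]
    (μ₀ : Measure A) [IsProbabilityMeasure μ₀]
    (hnontriv : ∀ a : A, μ₀ {a} ≠ 1)
    (μ : Measure (G → A)) [IsProbabilityMeasure μ] (hber : IsBernoulliMeasure G μ₀ μ)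
    (H : Type) [Group H] [Countable H]
    (c : G → (G → A) → H) (hc : IsCocycle G (G → A) H μ c) :
    ∃ δ : G →* H, Cohomologous G (G → A) H μ c fun g _ => δ g := by
  obtain rfl : μ = Measure.infinitePi fun _ : G => μ₀ := hber.eq_bern
  let _ : MeasurableSpace H := ⊤
  have _ : DiscreteMeasurableSpace H := ⟨fun _ => trivial⟩
  have hcm : ∀ g, Measurable (c g) := fun g => measurable_of_fibres (hc.1 g)
  have hcoc : ∀ g g', ∀ᵐ x ∂bern G μ₀, c (g * g') x = c g (shift g' x) * c g' x := hc.2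
  obtain ⟨ψ, hψm, hψ⟩ := exists_ae_const_of_centralizer μ₀ (Gs 0) (hinf 0 n.zero_le) hcent hcm hcoc
  set c' : G → (G → A) → H := fun g x => ψ (shift g x) * c g x * (ψ x)⁻¹ with hc'
  have hcm' : ∀ g, Measurable (c' g) := fun g =>
    ((hψm.comp (measurable_shift g)).mul (hcm g)).mul hψm.inv
  have hcoc' : ∀ g g', ∀ᵐ x ∂bern G μ₀, c' (g * g') x = c' g (shift g' x) * c' g' x :=
    fun g g' => (hcoc g g').mono fun x hx => by
      simp only [hc', hx, shift_mul]
      simp [mul_assoc]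
  have hconst : ∀ k ≤ n, ∀ g ∈ Gs k, ∃ y, ∀ᵐ x ∂bern G μ₀, c' g x = y := by
    intro k
    induction k with
    | zero => exact fun _ => hψ
    | succ k ih =>
      exact fun hk => exists_ae_const_of_wqNormal μ₀ hcm' hcoc' (ih (by omega)) (hwq k (by omega))
  choose δ hδ using fun g => hconst n le_rfl g (htop ▸ Subgroup.mem_top g)
  refine ⟨MonoidHom.mk' δ fun g g' => ?_, ψ, fun h => hψm (.of_discrete (s := {h})),
    fun g => (hδ g).mono fun x hx => hx.symm⟩
  obtain ⟨x, h1, h2, h3, h4⟩ := ((hδ (g * g')).and ((hδ g').and ((hcoc' g g').and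
    ((measurePreserving_shift μ₀ g').quasiMeasurePreserving.ae (hδ g))))).exists
  rw [← h1, h3, h2, h4]

end OEPaper
end

section
/- Let Γ be a finite simple graph, let G = G_Γ, let P be a join parabolic subgroup of G, and let S ⊆ P be a nontrivial parabolic subgroup of G. Then the subgroup generated by S ∪ S⊥ (which equals the internal direct product S × S⊥) is a join parabolic subgroup of G. -/
open MeasureTheory
open scoped ENNReal Pointwise symmDiff

namespace OEPaper

/-- The exponent-sum homomorphism of the vertex `t`. -/
noncomputable def exponentSum {V : Type} (Γ : SimpleGraph V) (t : V) :
    RAAG Γ →* Multiplicative ℤ :=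
  open Classical in
  PresentedGroup.toGroup (f := fun v => if v = t then Multiplicative.ofAdd 1 else 1) (by
    rintro r ⟨u, v, -, rfl⟩
    simp only [map_mul, map_inv, FreeGroup.lift_apply_of]
    rw [mul_inv_cancel_comm, mul_inv_cancel])

lemma exponentSum_gen_self {V : Type} (Γ : SimpleGraph V) (t : V) :
    exponentSum Γ t (gen Γ t) = Multiplicative.ofAdd 1 := by
  simp [exponentSum, gen]

lemma exponentSum_gen_of_ne {V : Type} (Γ : SimpleGraph V) {t v : V} (hv : v ≠ t) :
    exponentSum Γ t (gen Γ v) = 1 := by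
  simp [exponentSum, gen, hv]

/-- An inclusion of parabolic subgroups forces the inclusion of the underlying vertex sets. -/
lemma subset_of_conjSub_standardSub_le {V : Type} {Γ : SimpleGraph V} {g h : RAAG Γ}
    {T Λ : Set V} (hle : conjSub h (standardSub Γ T) ≤ conjSub g (standardSub Γ Λ)) :
    T ⊆ Λ := by
  intro t ht
  by_contra htΛ
  have hker : standardSub Γ Λ ≤ (exponentSum Γ t).ker := by
    rw [standardSub, Subgroup.closure_le]
    rintro _ ⟨v, hv, rfl⟩
    exact exponentSum_gen_of_ne Γ (ne_of_mem_of_not_mem hv htΛ)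
  obtain ⟨x, hx, hxt⟩ := hle (Subgroup.mem_map_of_mem (MulAut.conj h).toMonoidHom
    (Subgroup.subset_closure (Set.mem_image_of_mem (gen Γ) ht)))
  have hsum := congrArg (exponentSum Γ t) hxt
  have hx1 : exponentSum Γ t x = 1 := hker hx
  simp only [MulEquiv.coe_toMonoidHom, MulAut.conj_apply, map_mul, map_inv, hx1,
    exponentSum_gen_self, mul_one, mul_inv_cancel, mul_inv_cancel_comm] at hsum
  exact absurd (congrArg Multiplicative.toAdd hsum) (by decide)

/-- A nonempty vertex set `T` contained in a join spans a join together with `perp Γ T`. -/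
lemma IsJoin.union_perp {V : Type} {Γ : SimpleGraph V} {T Λ : Set V} (hΛ : IsJoin Γ Λ)
    (hTΛ : T ⊆ Λ) (hT : T.Nonempty) : IsJoin Γ (T ∪ perp Γ T) := by
  by_cases hperp : (perp Γ T).Nonempty
  · exact ⟨T, perp Γ T, hT, hperp, rfl, fun u hu v hv => (hv.2 u hu).symm⟩
  obtain ⟨A, B, ⟨a, ha⟩, ⟨b, hb⟩, rfl, hAB⟩ := hΛ
  rw [Set.not_nonempty_iff_eq_empty] at hperp
  rw [hperp, Set.union_empty]
  refine ⟨T ∩ A, T ∩ B, ?_, ?_, ?_, fun u hu v hv => hAB u hu.2 v hv.2⟩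
  · by_contra hTA
    have hTB : T ⊆ B := fun t ht =>
      (hTΛ ht).resolve_left fun htA => hTA ⟨t, ht, htA⟩
    have : a ∈ perp Γ T :=
      ⟨fun haT => Γ.irrefl (hAB a ha a (hTB haT)), fun u hu => hAB a ha u (hTB hu)⟩
    simp [hperp] at this
  · by_contra hTB
    have hTA : T ⊆ A := fun t ht =>
      (hTΛ ht).resolve_right fun htB => hTB ⟨t, ht, htB⟩
    have : b ∈ perp Γ T :=
      ⟨fun hbT => Γ.irrefl (hAB b (hTA hbT) b hb), fun u hu => (hAB u (hTA hu) b hb).symm⟩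
    simp [hperp] at this
  · rw [← Set.inter_union_distrib_left, Set.inter_eq_left.2 hTΛ]

lemma closure_conjSub_union {V : Type} (Γ : SimpleGraph V) (h : RAAG Γ) (S T : Set V) :
    Subgroup.closure ((conjSub h (standardSub Γ S) : Set (RAAG Γ)) ∪
      (conjSub h (standardSub Γ T) : Set (RAAG Γ))) = conjSub h (standardSub Γ (S ∪ T)) := by
  rw [← Subgroup.sup_eq_closure, conjSub, conjSub, ← Subgroup.map_sup, conjSub, standardSub,
    standardSub, standardSub, Set.image_union, Subgroup.closure_union]

/-- If `S` is a nontrivial parabolic subgroup contained in a join parabolic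
subgroup, then `S × S⊥` is a join parabolic subgroup. -/
theorem stmt9
    {V : Type} [Fintype V] (Γ : SimpleGraph V)
    (g : RAAG Γ) (Λ : Set V) (hΛ : IsJoin Γ Λ)
    (h : RAAG Γ) (T : Set V)
    (hle : conjSub h (standardSub Γ T) ≤ conjSub g (standardSub Γ Λ))
    (hnontriv : conjSub h (standardSub Γ T) ≠ ⊥) :
    IsJoinParabolic Γ (Subgroup.closure
      ((conjSub h (standardSub Γ T) : Set (RAAG Γ)) ∪
        (conjSub h (standardSub Γ (perp Γ T)) : Set (RAAG Γ)))) := by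
  have hT : T.Nonempty := by
    rw [Set.nonempty_iff_ne_empty]
    rintro rfl
    simp [conjSub, standardSub] at hnontriv
  exact ⟨h, T ∪ perp Γ T, hΛ.union_perp (subset_of_conjSub_standardSub_le hle) hT,
    closure_conjSub_union Γ h T (perp Γ T)⟩

end OEPaper
end

section
/- Let Γ be a finite simple graph such that G = G_Γ is one-ended (Γ is connected with at least two vertices) and centerless (no vertex of Γ is adjacent to every other vertex). Then either G contains a maximal join parabolic subgroup with trivial center, or G contains two distinct nonabelian maximal join parabolic subgroups P₁ ≠ P₂ such that every element of the center of P₁ commutes with every element of the center of P₂. -/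
open MeasureTheory
open scoped ENNReal Pointwise symmDiff

namespace OEPaper

/-- A map on vertices sending adjacent vertices to commuting elements extends to a
homomorphism from the right-angled Artin group. -/
def raagLift {V : Type} {Γ : SimpleGraph V} {H : Type} [Group H] (f : V → H)
    (hf : ∀ u v, Γ.Adj u v → Commute (f u) (f v)) : RAAG Γ →* H :=
  PresentedGroup.toGroup (f := f) (rels := raagRels Γ) (by
    rintro r ⟨u, v, huv, rfl⟩
    have := (hf u v huv).eq
    simp only [map_mul, map_inv, FreeGroup.lift_apply_of]
    rw [this]
    group)

lemma raagLift_gen {V : Type} {Γ : SimpleGraph V} {H : Type} [Group H] (f : V → H)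
    (hf : ∀ u v, Γ.Adj u v → Commute (f u) (f v)) (v : V) :
    raagLift f hf (gen Γ v) = f v :=
  PresentedGroup.toGroup.of _

lemma gen_commute {V : Type} {Γ : SimpleGraph V} {u v : V} (h : Γ.Adj u v) :
    Commute (gen Γ u) (gen Γ v) := by
  have : PresentedGroup.mk (raagRels Γ) (FreeGroup.of u * FreeGroup.of v *
      (FreeGroup.of u)⁻¹ * (FreeGroup.of v)⁻¹) = 1 :=
    (PresentedGroup.one_of_mem ⟨u, v, h, rfl⟩)
  simp only [map_mul, map_inv] at this
  exact mul_inv_eq_iff_eq_mul.1 (mul_inv_eq_one.1 this)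

lemma gen_mem_standardSub {V : Type} {Γ : SimpleGraph V} {S : Set V} {v : V} (h : v ∈ S) :
    gen Γ v ∈ standardSub Γ S :=
  Subgroup.subset_closure ⟨v, h, rfl⟩

lemma standardSub_mono {V : Type} {Γ : SimpleGraph V} {S T : Set V} (h : S ⊆ T) :
    standardSub Γ S ≤ standardSub Γ T :=
  Subgroup.closure_mono (Set.image_mono h)

lemma gen_ne_one {V : Type} (Γ : SimpleGraph V) (v : V) : gen Γ v ≠ 1 := by
  intro h
  have := congrArg (raagLift (Γ := Γ) (fun _ => Multiplicative.ofAdd (1 : ℤ))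
    (fun _ _ _ => Commute.refl _)) h
  rw [raagLift_gen, MonoidHom.map_one] at this
  exact one_ne_zero (α := ℤ) (Multiplicative.ofAdd.injective this)

open Classical in
/-- The retraction of a right-angled Artin group onto a standard subgroup. -/
noncomputable def retraction {V : Type} (Γ : SimpleGraph V) (B : Set V) : RAAG Γ →* RAAG Γ :=
  raagLift (fun v => if v ∈ B then gen Γ v else 1) (by
    intro u v huv
    split_ifs
    · exact gen_commute huv
    · exact Commute.one_right _
    · exact Commute.one_left _
    · exact Commute.one_left _)

lemma retraction_gen_of_mem {V : Type} {Γ : SimpleGraph V} {B : Set V} {v : V} (h : v ∈ B) :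
    retraction Γ B (gen Γ v) = gen Γ v := by
  simp [retraction, raagLift_gen, h]

lemma retraction_gen_of_notMem {V : Type} {Γ : SimpleGraph V} {B : Set V} {v : V} (h : v ∉ B) :
    retraction Γ B (gen Γ v) = 1 := by
  simp [retraction, raagLift_gen, h]

lemma retraction_eq_self {V : Type} {Γ : SimpleGraph V} {B : Set V} {x : RAAG Γ}
    (hx : x ∈ standardSub Γ B) : retraction Γ B x = x := by
  have : standardSub Γ B ≤ (retraction Γ B).eqLocus (MonoidHom.id _) := by
    rw [standardSub, Subgroup.closure_le]
    rintro _ ⟨v, hv, rfl⟩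
    exact retraction_gen_of_mem hv
  exact this hx

lemma gen_mem_standardSub_iff {V : Type} {Γ : SimpleGraph V} {S : Set V} {v : V} :
    gen Γ v ∈ standardSub Γ S ↔ v ∈ S := by
  refine ⟨fun h => ?_, gen_mem_standardSub⟩
  by_contra hv
  exact gen_ne_one Γ v ((retraction_eq_self h).symm.trans (retraction_gen_of_notMem hv))

lemma standardSub_inj {V : Type} {Γ : SimpleGraph V} {S T : Set V} :
    standardSub Γ S = standardSub Γ T ↔ S = T := by
  refine ⟨fun h => ?_, congrArg _⟩
  ext v
  rw [← gen_mem_standardSub_iff (Γ := Γ), h, gen_mem_standardSub_iff]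

lemma mem_standardSub_inter {V : Type} {Γ : SimpleGraph V} {A B : Set V} {x : RAAG Γ}
    (hA : x ∈ standardSub Γ A) (hB : x ∈ standardSub Γ B) : x ∈ standardSub Γ (A ∩ B) := by
  have : standardSub Γ A ≤ (standardSub Γ (A ∩ B)).comap (retraction Γ B) := by
    rw [standardSub, Subgroup.closure_le]
    rintro _ ⟨v, hv, rfl⟩
    rw [SetLike.mem_coe, Subgroup.mem_comap]
    by_cases hvB : v ∈ B
    · rw [retraction_gen_of_mem hvB]
      exact gen_mem_standardSub ⟨hv, hvB⟩
    · rw [retraction_gen_of_notMem hvB]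
      exact one_mem _
  have h := this hA
  rwa [Subgroup.mem_comap, retraction_eq_self hB] at h

open Classical in
lemma freeGroup_mem_zpowers_of_commute {α : Type} (a : α) :
    ∀ (n : ℕ) (f : FreeGroup α), f.toWord.length = n → Commute (FreeGroup.of a) f →
      f ∈ Subgroup.zpowers (FreeGroup.of a) := by
  intro n
  induction n using Nat.strong_induction_on with
  | _ n ih =>
    intro f hn hc
    rcases hw : f.toWord with _ | ⟨⟨b, e⟩, w⟩
    · rw [FreeGroup.toWord_eq_nil_iff.1 hw]
      exact one_mem _
    · have hf : f = FreeGroup.mk [(b, e)] * FreeGroup.mk w := by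
        rw [FreeGroup.mul_mk, List.singleton_append, ← hw, FreeGroup.mk_toWord]
      by_cases hb : b = a
      · subst hb
        have hmem : FreeGroup.mk [(b, e)] ∈ Subgroup.zpowers (FreeGroup.of b) := by
          cases e
          · exact inv_mem (Subgroup.mem_zpowers (FreeGroup.of b))
          · exact Subgroup.mem_zpowers (FreeGroup.of b)
        have hlen : (FreeGroup.mk w).toWord.length < n := by
          rw [FreeGroup.toWord_mk, ← hn, hw, List.length_cons]
          exact Nat.lt_succ_of_le (FreeGroup.reduce.red.length_le)
        have hcw : Commute (FreeGroup.of b) (FreeGroup.mk w) := by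
          have h1 : FreeGroup.mk w = (FreeGroup.mk [(b, e)])⁻¹ * f := by
            rw [hf, inv_mul_cancel_left]
          rw [h1]
          obtain ⟨k, hk⟩ := hmem
          refine Commute.mul_right (Commute.inv_right ?_) hc
          rw [← hk]
          exact Commute.zpow_right (Commute.refl _) k
        rw [hf]
        exact mul_mem hmem (ih _ hlen _ rfl hcw)
      · exfalso
        have h1 : (FreeGroup.of a * f).toWord = (a, true) :: (b, e) :: w := by
          rw [FreeGroup.toWord_mul, FreeGroup.toWord_of, List.singleton_append,
            FreeGroup.reduce.cons, FreeGroup.reduce_toWord, hw]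
          simp [Ne.symm hb]
        have h2 := FreeGroup.toWord_mul_sublist f (FreeGroup.of a)
        rw [← hc.eq, h1, FreeGroup.toWord_of, hw] at h2
        have h3 := h2.eq_of_length (by simp)
        simp only [List.cons_append, List.cons.injEq, Prod.mk.injEq] at h3
        exact hb h3.1.1.symm

/-- The action of a group by permuting the generators of the free group on a set of cosets. -/
def cosetPerm {G : Type} [Group G] (L : Subgroup G) : G →* MulAut (FreeGroup (G ⧸ L)) where
  toFun g := FreeGroup.freeGroupCongr (MulAction.toPerm g)
  map_one' := by
    apply MulEquiv.toMonoidHom_injective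
    apply FreeGroup.ext_hom
    intro x
    simp [FreeGroup.freeGroupCongr]
  map_mul' g h := by
    apply MulEquiv.toMonoidHom_injective
    apply FreeGroup.ext_hom
    intro x
    simp [FreeGroup.freeGroupCongr, mul_smul]

lemma cosetPerm_of {G : Type} [Group G] (L : Subgroup G) (g : G) (x : G ⧸ L) :
    cosetPerm L g (FreeGroup.of x) = FreeGroup.of (g • x) := by
  simp [cosetPerm, FreeGroup.freeGroupCongr]

/-- The set of vertices equal or adjacent to `v`. -/
def star {V : Type} (Γ : SimpleGraph V) (v : V) : Set V := {u | u = v ∨ Γ.Adj v u}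

lemma mem_star_comm {V : Type} {Γ : SimpleGraph V} {u v : V} : u ∈ star Γ v ↔ v ∈ star Γ u :=
  or_congr eq_comm (Γ.adj_comm v u)

lemma gen_commute_of_mem_link {V : Type} {Γ : SimpleGraph V} {s : V} {x : RAAG Γ}
    (hx : x ∈ standardSub Γ {u | Γ.Adj s u}) : Commute x (gen Γ s) := by
  have : standardSub Γ {u | Γ.Adj s u} ≤ Subgroup.centralizer {gen Γ s} := by
    rw [standardSub, Subgroup.closure_le]
    rintro _ ⟨v, hv, rfl⟩
    exact Subgroup.mem_centralizer_singleton_iff.2 (gen_commute hv.symm).eq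
  exact Subgroup.mem_centralizer_singleton_iff.1 (this hx)

/-- The centralizer of a generator is contained in the standard subgroup of its star. -/
lemma mem_standardSub_star_of_commute {V : Type} {Γ : SimpleGraph V} {s : V} {x : RAAG Γ}
    (hx : Commute x (gen Γ s)) : x ∈ standardSub Γ (star Γ s) := by
  classical
  let L : Subgroup (RAAG Γ) := standardSub Γ {u | Γ.Adj s u}
  let E := FreeGroup (RAAG Γ ⧸ L) ⋊[cosetPerm L] RAAG Γ
  let t : FreeGroup (RAAG Γ ⧸ L) := FreeGroup.of ((1 : RAAG Γ) : RAAG Γ ⧸ L)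
  have hlink : ∀ v, Γ.Adj s v →
      Commute (SemidirectProduct.inl t : E) (SemidirectProduct.inr (gen Γ v)) := by
    intro v hv
    have h1 : cosetPerm L (gen Γ v) t = t := by
      rw [cosetPerm_of]
      congr 1
      rw [MulAction.Quotient.smul_coe, smul_eq_mul, mul_one]
      refine (QuotientGroup.eq.2 ?_).symm
      simpa using gen_mem_standardSub (Γ := Γ) (S := {u | Γ.Adj s u}) hv
    refine SemidirectProduct.ext ?_ ?_ <;> simp [h1]
  let f : V → E := fun v => if v = s then SemidirectProduct.inl t
    else SemidirectProduct.inr (gen Γ v)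
  have hf : ∀ u v, Γ.Adj u v → Commute (f u) (f v) := by
    intro u v huv
    by_cases hu : u = s
    · have hv : v ≠ s := by rintro rfl; exact huv.ne hu
      simp only [f, if_pos hu, if_neg hv]
      exact hlink v (hu ▸ huv)
    · by_cases hv : v = s
      · simp only [f, if_neg hu, if_pos hv]
        exact (hlink u (hv ▸ huv.symm)).symm
      · simp only [f, if_neg hu, if_neg hv]
        exact (gen_commute huv).map SemidirectProduct.inr
  let Φ : RAAG Γ →* E := raagLift f hf
  let c : RAAG Γ ⧸ L → RAAG Γ := Quotient.lift (fun g => g * gen Γ s * g⁻¹) (by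
    intro a b hab
    have h : Commute (a⁻¹ * b) (gen Γ s) :=
      gen_commute_of_mem_link (QuotientGroup.leftRel_apply.1 hab)
    have h' := h.eq
    calc a * gen Γ s * a⁻¹ = a * (gen Γ s * (a⁻¹ * b)) * b⁻¹ := by group
      _ = a * (a⁻¹ * b * gen Γ s) * b⁻¹ := by rw [h']
      _ = b * gen Γ s * b⁻¹ := by group)
  have hc : ∀ g : RAAG Γ, c (g : RAAG Γ ⧸ L) = g * gen Γ s * g⁻¹ := fun _ => rfl
  let Ψ : E →* RAAG Γ := SemidirectProduct.lift (FreeGroup.lift c) (MonoidHom.id _) (by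
    intro g
    apply FreeGroup.ext_hom
    intro y
    induction y using QuotientGroup.induction_on with
    | H y =>
      simp only [MonoidHom.comp_apply, MulEquiv.coe_toMonoidHom, cosetPerm_of,
        FreeGroup.lift_apply_of, MulAction.Quotient.smul_coe, smul_eq_mul, hc,
        MulAut.conj_apply, MonoidHom.id_apply, mul_inv_rev, mul_assoc])
  have hΨt : FreeGroup.lift c t = gen Γ s := by
    simp only [t, FreeGroup.lift_apply_of, hc]
    simp
  have hid : ∀ y, Ψ (Φ y) = y := by
    have : Ψ.comp Φ = MonoidHom.id _ := by
      refine PresentedGroup.ext fun v => ?_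
      change Ψ (Φ (gen Γ v)) = gen Γ v
      simp only [Φ, raagLift_gen, f]
      split_ifs with h
      · rw [h, SemidirectProduct.lift_inl, hΨt]
      · rw [SemidirectProduct.lift_inr, MonoidHom.id_apply]
    exact fun y => DFunLike.congr_fun this y
  have hs : Φ (gen Γ s) = SemidirectProduct.inl t := by
    simp only [Φ, raagLift_gen, f, if_true]
  have hcomm : (Φ x).left * cosetPerm L (Φ x).right t = t * (Φ x).left := by
    have h := congrArg SemidirectProduct.left (hx.map Φ).eq
    rw [hs] at h
    change (Φ x).left * cosetPerm L (Φ x).right t = t * cosetPerm L 1 (Φ x).left at h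
    rwa [map_one, MulAut.one_apply] at h
  have hfix : cosetPerm L (Φ x).right t = t := by
    have h := congrArg (FreeGroup.lift (fun q => Abelianization.of (FreeGroup.of q))) hcomm
    rw [map_mul, map_mul, mul_comm, mul_right_cancel_iff, cosetPerm_of,
      FreeGroup.lift_apply_of, FreeGroup.lift_apply_of] at h
    rw [cosetPerm_of]
    have h2 := congrArg (Abelianization.lift (FreeGroup.lift
      (fun q => Multiplicative.ofAdd (if q = ((1 : RAAG Γ) : RAAG Γ ⧸ L) then (1 : ℤ) else 0)))) h
    simp only [Abelianization.lift_apply_of, FreeGroup.lift_apply_of, if_true,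
      EmbeddingLike.apply_eq_iff_eq] at h2
    by_contra hne
    rw [if_neg (fun h => hne (congrArg _ h))] at h2
    exact zero_ne_one h2
  have hR : (Φ x).right ∈ L := by
    rw [cosetPerm_of] at hfix
    have h := FreeGroup.of_injective hfix
    rw [MulAction.Quotient.smul_coe, smul_eq_mul, mul_one] at h
    simpa using QuotientGroup.eq.1 h.symm
  rw [hfix] at hcomm
  obtain ⟨k, hk⟩ := freeGroup_mem_zpowers_of_commute _ _ _ rfl (Commute.symm hcomm)
  have hxe : x = gen Γ s ^ k * (Φ x).right := by
    conv_lhs => rw [← hid x]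
    change FreeGroup.lift c (Φ x).left * (Φ x).right = _
    rw [← hk]
    change FreeGroup.lift c (t ^ k) * _ = _
    rw [map_zpow, hΨt]
  rw [hxe]
  exact mul_mem (zpow_mem (gen_mem_standardSub (S := star Γ s) (Or.inl rfl)) k)
    (standardSub_mono (fun _ h => Or.inr h) hR)

/-- The center of a standard subgroup is generated by cone vertices. -/
lemma mem_standardSub_of_mem_subCenter {V : Type} [Finite V] {Γ : SimpleGraph V} {S : Set V}
    {x : RAAG Γ} (hx : x ∈ subCenter (standardSub Γ S)) :
    x ∈ standardSub Γ {c ∈ S | S ⊆ star Γ c} := by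
  have key : ∀ F : Set V, F.Finite → F ⊆ S → x ∈ standardSub Γ {c ∈ S | F ⊆ star Γ c} := by
    intro F hF
    induction F, hF using Set.Finite.induction_on with
    | empty => intro _; simpa using hx.1
    | @insert a F _ _ ih =>
      intro hFS
      rw [Set.insert_subset_iff] at hFS
      have h1 := mem_standardSub_star_of_commute (hx.2 _ (gen_mem_standardSub hFS.1))
      refine standardSub_mono ?_ (mem_standardSub_inter (ih hFS.2) h1)
      rintro c ⟨⟨hcS, hcF⟩, hca⟩
      refine ⟨hcS, Set.insert_subset ?_ hcF⟩
      exact mem_star_comm.1 hca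
  exact key S S.toFinite subset_rfl

lemma conjSub_one {G : Type} [Group G] (P : Subgroup G) : conjSub 1 P = P := by
  ext x
  simp [conjSub]

lemma IsMaxJoin.isMaxJoinParabolic {V : Type} {Γ : SimpleGraph V} {S : Set V}
    (h : IsMaxJoin Γ S) : IsMaxJoinParabolic Γ (standardSub Γ S) :=
  ⟨1, S, h, (conjSub_one _).symm⟩

lemma IsJoin.exists_isMaxJoin {V : Type} [Finite V] {Γ : SimpleGraph V} {S : Set V}
    (h : IsJoin Γ S) : ∃ T, IsMaxJoin Γ T ∧ S ⊆ T := by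
  obtain ⟨T, hST, hT⟩ := Finite.exists_le_maximal h
  exact ⟨T, ⟨hT.prop, fun U hU hTU => hT.eq_of_subset hU hTU⟩, hST⟩

lemma isJoin_star {V : Type} {Γ : SimpleGraph V} {u v : V} (h : Γ.Adj v u) :
    IsJoin Γ (star Γ v) :=
  ⟨{v}, {w | Γ.Adj v w}, ⟨v, rfl⟩, ⟨u, h⟩, rfl, by rintro _ rfl w hw; exact hw⟩

lemma exists_adj_of_connected {V : Type} {Γ : SimpleGraph V} (hconn : Γ.Connected) {S : Set V}
    (hS : S.Nonempty) (hS' : S ≠ Set.univ) : ∃ u ∈ S, ∃ v ∉ S, Γ.Adj u v := by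
  obtain ⟨a, ha⟩ := hS
  obtain ⟨b, hb⟩ := (Set.ne_univ_iff_exists_notMem S).1 hS'
  obtain ⟨p⟩ := hconn.preconnected a b
  obtain ⟨d, -, h1, h2⟩ := p.exists_boundary_dart S ha hb
  exact ⟨_, h1, _, h2, d.adj⟩

lemma exists_not_commute_of_isMaxJoin_star {V : Type} {Γ : SimpleGraph V}
    (hconn : Γ.Connected) {v : V} (hv : star Γ v ≠ Set.univ) (hmax : IsMaxJoin Γ (star Γ v)) :
    ∃ x ∈ standardSub Γ (star Γ v), ∃ y ∈ standardSub Γ (star Γ v), x * y ≠ y * x := by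
  by_contra! hcomm
  obtain ⟨w, hw, x, hx, hwx⟩ := exists_adj_of_connected hconn ⟨v, Or.inl rfl⟩ hv
  have hsub : star Γ v ⊆ star Γ w := by
    intro u hu
    have h : Commute (gen Γ u) (gen Γ w) :=
      hcomm _ (gen_mem_standardSub hu) _ (gen_mem_standardSub hw)
    exact gen_mem_standardSub_iff.1 (mem_standardSub_star_of_commute h)
  rw [hmax.2 _ (isJoin_star hwx) hsub] at hx
  exact hx (Or.inr hwx)

/-- A one-ended centerless right-angled Artin group either has a maximal join
parabolic subgroup with trivial center, or has two distinct nonabelian maximal join parabolic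
subgroups with commuting centers. -/
theorem stmt11
    {V : Type} [Fintype V] (Γ : SimpleGraph V)
    (hconn : Γ.Connected) (hcard : 2 ≤ Fintype.card V)
    (hcenterless : ∀ v : V, ∃ u : V, u ≠ v ∧ ¬ Γ.Adj v u) :
    (∃ P : Subgroup (RAAG Γ), IsMaxJoinParabolic Γ P ∧ ∀ x ∈ subCenter P, x = 1) ∨
    (∃ P₁ P₂ : Subgroup (RAAG Γ), IsMaxJoinParabolic Γ P₁ ∧ IsMaxJoinParabolic Γ P₂ ∧
      P₁ ≠ P₂ ∧
      (∃ x ∈ P₁, ∃ y ∈ P₁, x * y ≠ y * x) ∧ (∃ x ∈ P₂, ∃ y ∈ P₂, x * y ≠ y * x) ∧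
      ∀ x ∈ subCenter P₁, ∀ y ∈ subCenter P₂, x * y = y * x) := by
  have hstar : ∀ v, star Γ v ≠ Set.univ := by
    intro v h
    obtain ⟨u, hne, hadj⟩ := hcenterless v
    rcases (h ▸ Set.mem_univ u : u ∈ star Γ v) with h | h
    exacts [hne h, hadj h]
  have hjoin : ∀ v, IsJoin Γ (star Γ v) := by
    intro v
    have : Nontrivial V := Fintype.one_lt_card_iff_nontrivial.1 hcard
    obtain ⟨u, hu⟩ := hconn.preconnected.exists_adj_of_nontrivial v
    exact isJoin_star hu
  by_cases hE : ∃ S, IsMaxJoin Γ S ∧ {c ∈ S | S ⊆ star Γ c} = ∅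
  · obtain ⟨S, hS, hempty⟩ := hE
    refine Or.inl ⟨_, hS.isMaxJoinParabolic, fun x hx => ?_⟩
    have h := mem_standardSub_of_mem_subCenter hx
    rw [hempty, standardSub, Set.image_empty, Subgroup.closure_empty] at h
    exact Subgroup.mem_bot.1 h
  · push Not at hE
    have hcover : ∀ w, ∃ v, IsMaxJoin Γ (star Γ v) ∧ star Γ w ⊆ star Γ v := by
      intro w
      obtain ⟨S, hS, hwS⟩ := (hjoin w).exists_isMaxJoin
      obtain ⟨c, -, hc⟩ := hE S hS
      have h := hS.2 _ (hjoin c) hc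
      exact ⟨c, h ▸ hS, h ▸ hwS⟩
    obtain ⟨v, hv, -⟩ := hcover hconn.nonempty.some
    obtain ⟨w, hw, x, hx, hwx⟩ := exists_adj_of_connected hconn ⟨v, Or.inl rfl⟩ (hstar v)
    obtain ⟨v', hv', hwv'⟩ := hcover w
    have hvv' : v ∈ star Γ v' := hwv' (mem_star_comm.1 hw)
    refine Or.inr ⟨_, _, hv.isMaxJoinParabolic, hv'.isMaxJoinParabolic, ?_,
      exists_not_commute_of_isMaxJoin_star hconn (hstar v) hv,
      exists_not_commute_of_isMaxJoin_star hconn (hstar v') hv', ?_⟩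
    · rw [Ne, standardSub_inj]
      exact fun h => hx (h ▸ hwv' (Or.inr hwx))
    · intro a ha b hb
      refine (hb.2 a (standardSub_mono ?_ (mem_standardSub_of_mem_subCenter ha))).symm
      rintro c ⟨-, hc⟩
      have hcv : star Γ v = star Γ c := hv.2 _ (hjoin c) hc
      have h : v' ∈ star Γ c := hcv ▸ mem_star_comm.1 hvv'
      exact mem_star_comm.1 h

end OEPaper
end
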